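/- arXiv:1311.4450 — 2 statements merged into one kernel-verified Lean document; each statement's English description precedes it below -/
import Mathlib

section
/- Let X be a δ-hyperbolike graph with base vertex x which is nonelementary (X is infinite and not quasi-isometric to a point or a line), and let X_{=n} = {y : d(x,y) = n} be the sphere of radius n. Then there are constants λ > 1 and C > 1 such that C⁻¹ λⁿ ≤ |X_{=n}| ≤ C λⁿ for all n ≥ 0; moreover λ can be taken to be the same constant as in the corresponding estimate C′⁻¹λⁿ ≤ |X_n| ≤ C′λⁿ for balls. -/
open SimpleGraph Filter

namespace CF

variable {V : Type*}

/-- A walk in a graph is a geodesic if its length realizes the graph distance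
between its endpoints. -/
def IsGeodesic (G : SimpleGraph V) {u v : V} (p : G.Walk u v) : Prop :=
  p.length = G.dist u v

/-- `G` is δ-hyperbolic: every geodesic triangle is δ-thin, i.e. each side lies
in the δ-neighborhood of the union of the other two sides. -/
def IsDeltaHyperbolic (G : SimpleGraph V) (δ : ℝ) : Prop :=
  ∀ ⦃a b c : V⦄ (p : G.Walk a b) (q : G.Walk b c) (r : G.Walk a c),
    IsGeodesic G p → IsGeodesic G q → IsGeodesic G r →
      (∀ z ∈ p.support, ∃ w, (w ∈ q.support ∨ w ∈ r.support) ∧ (G.dist z w : ℝ) ≤ δ) ∧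
      (∀ z ∈ q.support, ∃ w, (w ∈ p.support ∨ w ∈ r.support) ∧ (G.dist z w : ℝ) ≤ δ) ∧
      (∀ z ∈ r.support, ∃ w, (w ∈ p.support ∨ w ∈ q.support) ∧ (G.dist z w : ℝ) ≤ δ)

/-- `G` has uniformly finite valence. -/
def UnifFiniteValence (G : SimpleGraph V) : Prop :=
  ∃ D : ℕ, ∀ v : V, (G.neighborSet v).Finite ∧ (G.neighborSet v).ncard ≤ D

/-- The automorphism group of `G` acts transitively on vertices. -/
def VertexTransitive (G : SimpleGraph V) : Prop :=
  ∀ u v : V, ∃ φ : G ≃g G, φ u = v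

/-- A δ-hyperbolike graph: connected, of uniformly finite valence, δ-hyperbolic
(with δ ≥ 0), and vertex-transitive. -/
def Hyperbolike (G : SimpleGraph V) (δ : ℝ) : Prop :=
  G.Connected ∧ UnifFiniteValence G ∧ 0 ≤ δ ∧ IsDeltaHyperbolic G δ ∧ VertexTransitive G

/-- The ball of radius `n` about `x` (as a vertex set). -/
def ball (G : SimpleGraph V) (x : V) (n : ℕ) : Set V := {y | G.dist x y ≤ n}

/-- A formal power series over ℝ is rational if `q·P = p` for polynomials `p`, `q`
with `q(0) ≠ 0`. -/
def IsRationalPS (P : PowerSeries ℝ) : Prop :=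
  ∃ p q : Polynomial ℝ, q.coeff 0 ≠ 0 ∧ (q : PowerSeries ℝ) * P = (p : PowerSeries ℝ)

/-- Two geodesics starting at the same point `T`-synchronously fellow travel:
`d(γ(ℓ−i), γ′(ℓ′−i)) ≤ T` for all `0 ≤ i ≤ min(ℓ,ℓ′)`. -/
def SyncFellowTravel (G : SimpleGraph V) (T : ℝ) {x y z : V}
    (p : G.Walk x y) (q : G.Walk x z) : Prop :=
  ∀ i : ℕ, i ≤ min p.length q.length →
    (G.dist (p.getVert (p.length - i)) (q.getVert (q.length - i)) : ℝ) ≤ T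

/-- `z` is a competitor of `y` (with respect to the base point `x`):
`z ∈ B_{2δ+1}(y)`, `d(x,z) ≤ d(x,y)`, and some geodesic from `x` to `z`
`(2δ+1)`-synchronously fellow travels every geodesic from `x` to `y`. -/
def Competitor (G : SimpleGraph V) (δ : ℝ) (x y z : V) : Prop :=
  (G.dist y z : ℝ) ≤ 2*δ+1 ∧ G.dist x z ≤ G.dist x y ∧
  ∃ p : G.Walk x z, IsGeodesic G p ∧
    ∀ q : G.Walk x y, IsGeodesic G q → SyncFellowTravel G (2*δ+1) p q

/-- `F` is a tournament at `y` (with base point `x`); only the values of `F` on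
the ball `B_{2δ+1}(y)` are constrained. -/
def Tournament (G : SimpleGraph V) (δ : ℝ) (x y : V) (F : V → ℤ) : Prop :=
  (∀ z : V, (G.dist y z : ℝ) ≤ 2*δ+1 →
    (G.dist x z : ℤ) - (G.dist x y : ℤ) ≤ F z ∧ F z ≤ (G.dist y z : ℤ)) ∧
  (∀ z : V, Competitor G δ x y z → (G.dist x z : ℤ) = (G.dist x y : ℤ) + F z)

/-- Tournaments `(y,F)` and `(y',F')` have the same type: some automorphism `φ`
carries `y` to `y'` with `F = F' ∘ φ` (on the ball `B_{2δ+1}(y)`). -/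
def SameTournamentType (G : SimpleGraph V) (δ : ℝ) (y y' : V) (F F' : V → ℤ) : Prop :=
  ∃ φ : G ≃g G, φ y = y' ∧ ∀ z : V, (G.dist y z : ℝ) ≤ 2*δ+1 → F z = F' (φ z)

/-- The cone of `y` with respect to the base point `x`. -/
def cone (G : SimpleGraph V) (x y : V) : Set V :=
  {z | G.dist x z = G.dist x y + G.dist y z}

/-- There is a quasi-isometry from the vertices of `G` (with the path metric) to ℝ. -/
def QuasiIsometricToReal (G : SimpleGraph V) : Prop :=
  ∃ (f : V → ℝ) (C : ℝ), 1 ≤ C ∧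
    (∀ u v : V, (G.dist u v : ℝ)/C - C ≤ |f u - f v| ∧ |f u - f v| ≤ C * G.dist u v + C) ∧
    (∀ r : ℝ, ∃ v : V, |r - f v| ≤ C)

/-- `G` is nonelementary: infinitely many vertices and not quasi-isometric to ℝ. -/
def Nonelementary (G : SimpleGraph V) : Prop :=
  Infinite V ∧ ¬ QuasiIsometricToReal G

/-- `ω` is an opposite series of the power series with (positive) coefficients `a`:
the polynomials `Xₙ(P)(s) = Σ_{k≤n} (a_{n-k}/aₙ) s^k` accumulate coefficientwise at `ω`
along some strictly increasing sequence of indices. -/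
def OppositeSeries (a : ℕ → ℝ) (ω : ℕ → ℝ) : Prop :=
  ∃ φ : ℕ → ℕ, StrictMono φ ∧
    ∀ k : ℕ, Tendsto (fun j => a (φ j - k) / a (φ j)) atTop (nhds (ω k))

end CF

namespace CF

section Geometry

variable {G : SimpleGraph V}

/-- The four-point form of Gromov hyperbolicity, with an integral constant. -/
def FourPoint (G : SimpleGraph V) (D : ℕ) : Prop :=
  ∀ w x y z : V, G.dist w y + G.dist x z ≤
    max (G.dist w x + G.dist y z) (G.dist w z + G.dist x y) + D

lemma exists_dist_split (hc : G.Connected) (u v : V) {k : ℕ} (hk : k ≤ G.dist u v) :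
    ∃ w, G.dist u w = k ∧ G.dist w v + k = G.dist u v := by
  obtain ⟨p, hp⟩ := hc.exists_walk_length_eq_dist u v
  refine ⟨p.getVert k, ?_⟩
  have h1 := dist_le (p.take k)
  have h2 := dist_le (p.drop k)
  have h3 := hc.dist_triangle (u := u) (v := p.getVert k) (w := v)
  rw [Walk.take_length] at h1
  rw [Walk.drop_length] at h2
  omega

lemma IsGeodesic.dist_add_dist (hc : G.Connected) {u v z : V} {p : G.Walk u v}
    (hp : IsGeodesic G p) (hz : z ∈ p.support) : G.dist u z + G.dist z v = G.dist u v := by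
  classical
  have h1 := dist_le (p.takeUntil z hz)
  have h2 := dist_le (p.dropUntil z hz)
  have h3 := hc.dist_triangle (u := u) (v := z) (w := v)
  have h4 := congrArg Walk.length (p.take_spec hz)
  rw [Walk.length_append] at h4
  unfold IsGeodesic at hp
  omega

lemma dist_map_iso (hc : G.Connected) (φ : G ≃g G) (u v : V) :
    G.dist (φ u) (φ v) = G.dist u v := by
  have key : ∀ (ψ : G ≃g G) (a b : V), G.dist (ψ a) (ψ b) ≤ G.dist a b := fun ψ a b => by
    obtain ⟨p, hp⟩ := hc.exists_walk_length_eq_dist a b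
    simpa [hp] using dist_le (p.map ψ.toHom)
  refine le_antisymm (key φ u v) ?_
  simpa using key φ.symm (φ u) (φ v)

/-- In a thin triangle with vertices `w`, `x`, `z`, some point of the side `[x, z]` is close to
both other sides. -/
lemma exists_mem_side_dist_le (hc : G.Connected) {δ : ℝ} (h : IsDeltaHyperbolic G δ)
    (w : V) {x z : V} {q : G.Walk x z} (hq : IsGeodesic G q) :
    ∃ u ∈ q.support, G.dist x z + 2 * G.dist w u ≤ G.dist w x + G.dist w z + 4 * (⌊δ⌋₊ + 1) := by
  classical
  obtain ⟨p, hp⟩ := hc.exists_walk_length_eq_dist w x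
  obtain ⟨r, hr⟩ := hc.exists_walk_length_eq_dist w z
  have hthin := (h p q r hp hq hr).2.1
  let near : ℕ → Prop := fun i => ∃ t ∈ r.support, G.dist (q.getVert i) t ≤ ⌊δ⌋₊
  have hex : ∃ i, near i :=
    ⟨q.length, z, r.end_mem_support, by simp⟩
  have hfst : ∃ s ∈ p.support, G.dist (q.getVert (Nat.find hex)) s ≤ ⌊δ⌋₊ + 1 := by
    rcases hi : Nat.find hex with _ | i
    · exact ⟨x, p.end_mem_support, by simp⟩
    · have hnot : ¬ near i := Nat.find_min hex (by omega)
      obtain ⟨s, hs, hd⟩ := hthin (q.getVert i) (q.getVert_mem_support i)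
      have hd' := Nat.le_floor hd
      rcases hs with hs | hs
      · refine ⟨s, hs, ?_⟩
        have h1 : G.dist (q.getVert (i + 1)) (q.getVert i) ≤ 1 := by
          by_cases hlt : i < q.length
          · exact (dist_eq_one_iff_adj.2 (q.adj_getVert_succ hlt).symm).le
          · rw [q.getVert_of_length_le (by omega : q.length ≤ i + 1),
              q.getVert_of_length_le (by omega : q.length ≤ i)]
            simp
        have := hc.dist_triangle (u := q.getVert (i + 1)) (v := q.getVert i) (w := s)
        omega
      · exact absurd ⟨s, hs, hd'⟩ hnot
  obtain ⟨t, ht, htd⟩ := Nat.find_spec hex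
  obtain ⟨s, hs, hsd⟩ := hfst
  set u := q.getVert (Nat.find hex)
  have huq : u ∈ q.support := q.getVert_mem_support _
  refine ⟨u, huq, ?_⟩
  have e1 := IsGeodesic.dist_add_dist hc hp hs
  have e2 := IsGeodesic.dist_add_dist hc hr ht
  have e3 := IsGeodesic.dist_add_dist hc hq huq
  have t1 := hc.dist_triangle (u := w) (v := s) (w := u)
  have t2 := hc.dist_triangle (u := w) (v := t) (w := u)
  have t3 := hc.dist_triangle (u := u) (v := s) (w := x)
  have t4 := hc.dist_triangle (u := u) (v := t) (w := z)
  have c1 := G.dist_comm (u := s) (v := u)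
  have c2 := G.dist_comm (u := t) (v := u)
  have c3 := G.dist_comm (u := x) (v := u)
  omega

lemma IsDeltaHyperbolic.fourPoint (hc : G.Connected) {δ : ℝ}
    (h : IsDeltaHyperbolic G δ) : FourPoint G (6 * ⌊δ⌋₊ + 4) := by
  intro w x y z
  obtain ⟨p, hp⟩ := hc.exists_walk_length_eq_dist x y
  obtain ⟨q, hq⟩ := hc.exists_walk_length_eq_dist y z
  obtain ⟨r, hr⟩ := hc.exists_walk_length_eq_dist x z
  obtain ⟨u, hu, hud⟩ := exists_mem_side_dist_le hc h w hr
  obtain ⟨v, hv, hd⟩ := (h p q r hp hq hr).2.2 u hu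
  have hd' := Nat.le_floor hd
  have t0 := hc.dist_triangle (u := w) (v := u) (w := v)
  have t1 := hc.dist_triangle (u := w) (v := v) (w := x)
  have t2 := hc.dist_triangle (u := w) (v := v) (w := y)
  have t3 := hc.dist_triangle (u := w) (v := v) (w := z)
  have c1 := G.dist_comm (u := x) (v := v)
  have c2 := G.dist_comm (u := y) (v := v)
  rcases hv with hv | hv
  · have e := IsGeodesic.dist_add_dist hc hp hv
    omega
  · have e := IsGeodesic.dist_add_dist hc hq hv
    omega

lemma finite_ball (hc : G.Connected) (hv : UnifFiniteValence G) (x : V) (n : ℕ) :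
    (ball G x n).Finite := by
  obtain ⟨D, hD⟩ := hv
  induction n with
  | zero =>
    refine (Set.finite_singleton x).subset fun y hy => ?_
    have : G.dist x y = 0 := Nat.le_zero.1 hy
    exact (hc.dist_eq_zero_iff.1 this).symm
  | succ n ih =>
    refine (ih.union (ih.biUnion fun v _ => (hD v).1)).subset fun y hy => ?_
    change G.dist x y ≤ n + 1 at hy
    by_cases hn : G.dist x y ≤ n
    · exact Or.inl hn
    · obtain ⟨w, hw, hw'⟩ := exists_dist_split hc x y (k := n) (by omega)
      refine Or.inr (Set.mem_biUnion (show w ∈ ball G x n from hw.le) ?_)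
      exact dist_eq_one_iff_adj.1 (by omega)

lemma exists_dist_eq (hc : G.Connected) (hfin : ∀ x n, (ball G x n).Finite) [Infinite V]
    (x : V) (n : ℕ) : ∃ y, G.dist x y = n := by
  obtain ⟨y, hy⟩ := (hfin x n).exists_notMem
  change ¬ G.dist x y ≤ n at hy
  obtain ⟨w, hw, -⟩ := exists_dist_split hc x y (k := n) (by omega)
  exact ⟨w, hw⟩

/-- `v` is the centre of a tripod with legs of length `L` and pairwise Gromov products at most
`K / 2`. -/
def IsTripodCenter (G : SimpleGraph V) (K L : ℕ) (v : V) : Prop :=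
  ∃ a b c : V, (G.dist v a = L ∧ G.dist v b = L ∧ G.dist v c = L) ∧
    2 * L ≤ G.dist a b + K ∧ 2 * L ≤ G.dist a c + K ∧ 2 * L ≤ G.dist b c + K

lemma IsTripodCenter.map_iso (hc : G.Connected) {K L : ℕ} {v : V} (h : IsTripodCenter G K L v)
    (φ : G ≃g G) : IsTripodCenter G K L (φ v) := by
  obtain ⟨a, b, c, h⟩ := h
  exact ⟨φ a, φ b, φ c, by simpa only [dist_map_iso hc] using h⟩

/-- If every vertex is the centre of a tripod with long legs, then balls contain the leaves of
embedded binary trees. -/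
lemma exists_finset_card_eq_two_pow (hc : G.Connected) {D K L : ℕ} (h4 : FourPoint G D)
    (hL : K + 2 * D < L) (hT : ∀ v, IsTripodCenter G K L v) (k : ℕ) :
    ∀ v q : V, ∃ T : Finset V, T.card = 2 ^ k ∧ ∀ t ∈ T, G.dist v t ≤ k * L ∧
      G.dist q v + G.dist v t ≤ G.dist q t + (K + 2 * D) := by
  classical
  induction k with
  | zero => exact fun v q => ⟨{v}, by simp, by simp⟩
  | succ k ih =>
    have step : ∀ v q a b : V, G.dist v a = L → G.dist v b = L → 2 * L ≤ G.dist a b + K →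
        G.dist q v + L ≤ G.dist q a + (K + D) → G.dist q v + L ≤ G.dist q b + (K + D) →
        ∃ T : Finset V, T.card = 2 ^ (k + 1) ∧ ∀ t ∈ T, G.dist v t ≤ (k + 1) * L ∧
          G.dist q v + G.dist v t ≤ G.dist q t + (K + 2 * D) := by
      intro v q a b ha hb hab hqa hqb
      obtain ⟨S, hS, hS'⟩ := ih a v
      obtain ⟨T, hT, hT'⟩ := ih b v
      have leg : ∀ a t, G.dist v a = L → G.dist q v + L ≤ G.dist q a + (K + D) →
          (G.dist a t ≤ k * L ∧ G.dist v a + G.dist a t ≤ G.dist v t + (K + 2 * D)) →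
          G.dist v t ≤ (k + 1) * L ∧ G.dist q v + G.dist v t ≤ G.dist q t + (K + 2 * D) := by
        intro a t ha hqa ⟨h1, h2⟩
        have t1 := hc.dist_triangle (u := v) (v := a) (w := t)
        have := h4 v q t a
        have c1 := G.dist_comm (u := q) (v := v)
        have c2 := G.dist_comm (u := t) (v := a)
        rw [add_one_mul]
        omega
      refine ⟨S ∪ T, ?_, ?_⟩
      · rw [Finset.card_union_of_disjoint, hS, hT, pow_succ, mul_two]
        refine Finset.disjoint_left.2 fun t ht ht' => ?_
        have h1 := (hS' t ht).2
        have h2 := (hT' t ht').2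
        have := h4 v a t b
        have c2 := G.dist_comm (u := t) (v := b)
        omega
      · intro t ht
        rcases Finset.mem_union.1 ht with ht | ht
        · exact leg a t ha hqa (hS' t ht)
        · exact leg b t hb hqb (hT' t ht)
    intro v q
    obtain ⟨a, b, c, ⟨ha, hb, hc'⟩, hab, hac, hbc⟩ := hT v
    have i1 := h4 v a q b
    have i2 := h4 v a q c
    have i3 := h4 v b q c
    have c1 := G.dist_comm (u := q) (v := v)
    have c2 := G.dist_comm (u := q) (v := a)
    have c3 := G.dist_comm (u := q) (v := b)
    by_cases g1 : G.dist q v + L ≤ G.dist q a + (K + D)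
    · by_cases g2 : G.dist q v + L ≤ G.dist q b + (K + D)
      · exact step v q a b ha hb hab g1 g2
      · exact step v q a c ha hc' hac g1 (by omega)
    · exact step v q b c hb hc' hbc (by omega) (by omega)

/-- Away from its ends, a geodesic in a graph without tripods coarsely contains every vertex. -/
lemma dist_add_dist_le_of_forall_not_isTripodCenter (hc : G.Connected) {D L : ℕ}
    (h4 : FourPoint G D) (hT : ∀ v, ¬ IsTripodCenter G (D + 1) L v) {x a b w : V} {N : ℕ}
    (ha : G.dist x a = N) (hb : G.dist x b = N) (hab : G.dist a b = 2 * N)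
    (hw : G.dist x w + L + 1 ≤ N) : G.dist w a + G.dist w b ≤ 2 * N + 2 * L := by
  have t1 := hc.dist_triangle (u := w) (v := x) (w := a)
  have t2 := hc.dist_triangle (u := w) (v := x) (w := b)
  have t3 := hc.dist_triangle (u := a) (v := w) (w := b)
  have c1 := G.dist_comm (u := x) (v := w)
  have c2 := G.dist_comm (u := w) (v := a)
  obtain ⟨o, ho, ho'⟩ := exists_dist_split hc a b
    (k := (2 * N + G.dist w a - G.dist w b) / 2) (by omega)
  have f := h4 w a o b
  have c3 := G.dist_comm (u := o) (v := a)
  have t4 := hc.dist_triangle (u := w) (v := o) (w := a)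
  have t5 := hc.dist_triangle (u := w) (v := o) (w := b)
  by_contra hcon
  have c4 := G.dist_comm (u := o) (v := w)
  obtain ⟨a', ha', ha''⟩ := exists_dist_split hc o a (k := L) (by omega)
  obtain ⟨b', hb', hb''⟩ := exists_dist_split hc o b (k := L) (by omega)
  obtain ⟨w', hw', hw''⟩ := exists_dist_split hc o w (k := L) (by omega)
  have path : ∀ p p' q q' : V, G.dist p q ≤ G.dist p' p + G.dist p' q' + G.dist q' q := by
    intro p p' q q'
    have s1 := hc.dist_triangle (u := p) (v := p') (w := q)
    have s2 := hc.dist_triangle (u := p') (v := q') (w := q)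
    have s3 := G.dist_comm (u := p) (v := p')
    omega
  have p1 := path a a' b b'
  have p2 := path a a' w w'
  have p3 := path b b' w w'
  have c5 := G.dist_comm (u := w) (v := b)
  exact hT o ⟨a', b', w', ⟨ha', hb', hw'⟩, by omega, by omega, by omega⟩

lemma exists_midpoint_eq (hc : G.Connected) (hfin : ∀ x n, (ball G x n).Finite)
    (ht : VertexTransitive G) [Infinite V] (x : V) (N : ℕ) :
    ∃ a b, G.dist x a = N ∧ G.dist x b = N ∧ G.dist a b = 2 * N := by
  obtain ⟨y, hy⟩ := exists_dist_eq hc hfin x (2 * N)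
  obtain ⟨w, hw, hw'⟩ := exists_dist_split hc x y (k := N) (by omega)
  obtain ⟨φ, hφ⟩ := ht w x
  refine ⟨φ x, φ y, ?_, ?_, ?_⟩
  · have := dist_map_iso hc φ w x
    rw [hφ] at this
    rw [this, dist_comm, hw]
  · have := dist_map_iso hc φ w y
    rw [hφ] at this
    omega
  · rw [dist_map_iso hc, hy]

/-- A vertex-transitive hyperbolic graph without tripods is quasi-isometric to the line, via a
Busemann function. -/
lemma quasiIsometricToReal_of_forall_not_isTripodCenter (hc : G.Connected)
    (hfin : ∀ x n, (ball G x n).Finite) (ht : VertexTransitive G) [Infinite V] {D L : ℕ}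
    (h4 : FourPoint G D) (hT : ∀ v, ¬ IsTripodCenter G (D + 1) L v) :
    QuasiIsometricToReal G := by
  obtain ⟨x⟩ := hc.nonempty
  choose a b ha hb hab using exists_midpoint_eq hc hfin ht x
  let U : Ultrafilter ℕ := hyperfilter ℕ
  have hU : ∀ m : ℕ, ∀ᶠ N in (U : Filter ℕ), m ≤ N := fun m =>
    Nat.hyperfilter_le_atTop (eventually_ge_atTop m)
  have hlim : ∀ w, ∃ k : ℤ, ∀ᶠ N in (U : Filter ℕ), (G.dist w (a N) : ℤ) - N = k := by
    intro w
    have := (U.eventually_exists_mem_iff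
      (P := fun (k : ℤ) (N : ℕ) => (G.dist w (a N) : ℤ) - N = k)
      (Set.finite_Icc (-(G.dist x w : ℤ)) (G.dist x w))).1 (Eventually.of_forall fun N => by
        refine ⟨_, ?_, rfl⟩
        have t1 := hc.dist_triangle (u := w) (v := x) (w := a N)
        have t2 := hc.dist_triangle (u := x) (v := w) (w := a N)
        have c1 := G.dist_comm (u := x) (v := w)
        have := ha N
        rw [Set.mem_Icc]
        omega)
    exact this.imp fun _ h => h.2
  choose f hf using hlim
  have hupper : ∀ u v, |f u - f v| ≤ G.dist u v := by
    intro u v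
    obtain ⟨N, h1, h2⟩ := ((hf u).and (hf v)).exists
    have t1 := hc.dist_triangle (u := u) (v := v) (w := a N)
    have t2 := hc.dist_triangle (u := v) (v := u) (w := a N)
    have c1 := G.dist_comm (u := u) (v := v)
    rw [abs_le]
    omega
  have hlower : ∀ u v, (G.dist u v : ℤ) ≤ |f u - f v| + (2 * L + D : ℕ) := by
    intro u v
    obtain ⟨N, ⟨h1, h2⟩, h3, h4'⟩ := (((hf u).and (hf v)).and
      ((hU (G.dist x u + L + 1)).and (hU (G.dist x v + L + 1)))).exists
    have d1 := dist_add_dist_le_of_forall_not_isTripodCenter hc h4 hT (ha N) (hb N) (hab N) h3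
    have d2 := dist_add_dist_le_of_forall_not_isTripodCenter hc h4 hT (ha N) (hb N) (hab N) h4'
    have f1 := h4 u (a N) v (b N)
    have c1 := G.dist_comm (u := a N) (v := v)
    have := hab N
    have l1 := le_abs_self (f u - f v)
    have l2 := neg_abs_le (f u - f v)
    omega
  have hsurj : ∀ k : ℤ, ∃ w, f w = k := by
    intro k
    have hex : ∀ᶠ N in (U : Filter ℕ), ∃ w ∈ ball G x k.natAbs,
        (G.dist w (a N) : ℤ) - N = k := by
      filter_upwards [hU k.natAbs] with N hN
      have h1 := ha N
      have h2 := hb N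
      have h3 := hab N
      rcases le_total k 0 with hk | hk
      · obtain ⟨w, hw, hw'⟩ := exists_dist_split hc x (a N) (k := k.natAbs) (by omega)
        exact ⟨w, hw.le, by omega⟩
      · obtain ⟨w, hw, hw'⟩ := exists_dist_split hc x (b N) (k := k.natAbs) (by omega)
        have t1 := hc.dist_triangle (u := a N) (v := w) (w := b N)
        have t2 := hc.dist_triangle (u := w) (v := x) (w := a N)
        have c1 := G.dist_comm (u := a N) (v := w)
        have c2 := G.dist_comm (u := x) (v := w)
        exact ⟨w, hw.le, by omega⟩
    obtain ⟨w, -, hw⟩ := (U.eventually_exists_mem_iff (hfin x k.natAbs)).1 hex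
    obtain ⟨N, h1, h2⟩ := (hw.and (hf w)).exists
    exact ⟨w, by omega⟩
  have hC : (1 : ℝ) ≤ (2 * L + D : ℕ) + 1 := by
    have : (0 : ℝ) ≤ (2 * L + D : ℕ) := Nat.cast_nonneg _
    linarith
  refine ⟨fun v => f v, (2 * L + D : ℕ) + 1, hC, fun u v => ⟨?_, ?_⟩, fun r => ?_⟩
  · have h1 : (G.dist u v : ℝ) ≤ |(f u : ℝ) - f v| + (2 * L + D : ℕ) := by
      exact_mod_cast hlower u v
    have h2 : (G.dist u v : ℝ) / ((2 * L + D : ℕ) + 1) ≤ G.dist u v :=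
      div_le_self (Nat.cast_nonneg _) hC
    linarith
  · have h1 : |(f u : ℝ) - f v| ≤ G.dist u v := by exact_mod_cast hupper u v
    nlinarith [(Nat.cast_nonneg (G.dist u v) : (0 : ℝ) ≤ _)]
  · obtain ⟨w, hw⟩ := hsurj ⌊r⌋
    refine ⟨w, ?_⟩
    beta_reduce
    rw [hw, abs_of_nonneg (sub_nonneg.2 (Int.floor_le r))]
    linarith [Int.lt_floor_add_one r]

end Geometry

section Growth

lemma exists_one_lt_pow_lt (n : ℕ) {t : ℝ} (ht : 1 < t) : ∃ κ : ℝ, 1 < κ ∧ κ ^ n < t := by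
  have h : ∀ᶠ κ : ℝ in nhds 1, κ ^ n < t :=
    ((continuous_pow n).tendsto' (1 : ℝ) 1 (one_pow n)).eventually_lt_const ht
  obtain ⟨κ, h1, h2⟩ := ((h.filter_mono nhdsWithin_le_nhds).and
    (self_mem_nhdsWithin : Set.Ioi (1 : ℝ) ∈ nhdsWithin 1 (Set.Ioi 1))).exists
  exact ⟨κ, h2, h1⟩

lemma not_forall_pow_le_mul_pow {A q r : ℝ} (hq : 0 < q) (hqr : q < r) :
    ¬ ∀ k : ℕ, r ^ k ≤ A * q ^ k := by
  intro h
  obtain ⟨k, hk⟩ := pow_unbounded_of_one_lt A ((one_lt_div hq).2 hqr)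
  rw [div_pow, lt_div_iff₀ (pow_pos hq k)] at hk
  exact (h k).not_gt hk

/-- Fekete's lemma for submultiplicative sequences of positive integers. -/
lemma exists_growth_rate {s : ℕ → ℕ} (hpos : ∀ n, 0 < s n)
    (hsub : ∀ m n, s (m + n) ≤ s m * s n) :
    ∃ lam : ℝ, 1 ≤ lam ∧ (∀ n, lam ^ n ≤ s n) ∧
      ∀ μ, lam < μ → ∃ C : ℝ, ∀ n, (s n : ℝ) ≤ C * μ ^ n := by
  have hpos' : ∀ n, (0 : ℝ) < s n := fun n => Nat.cast_pos.2 (hpos n)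
  have hone : ∀ n, (1 : ℝ) ≤ s n := fun n => Nat.one_le_cast.2 (hpos n)
  have hu : Subadditive fun n => Real.log (s n) := by
    intro m n
    rw [← Real.log_mul (hpos' m).ne' (hpos' n).ne']
    exact Real.log_le_log (hpos' _) (by exact_mod_cast hsub m n)
  have hnn : ∀ n : ℕ, 0 ≤ Real.log (s n) / n := fun n =>
    div_nonneg (Real.log_nonneg (hone n)) n.cast_nonneg
  have hbdd : BddBelow (Set.range fun n : ℕ => Real.log (s n) / n) :=
    ⟨0, by rintro _ ⟨n, rfl⟩; exact hnn n⟩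
  have hlim := hu.tendsto_lim hbdd
  refine ⟨Real.exp hu.lim, Real.one_le_exp (ge_of_tendsto' hlim hnn), fun n => ?_, fun μ hμ => ?_⟩
  · rcases eq_or_ne n 0 with rfl | hn
    · simpa using hone 0
    · have hn' : (0 : ℝ) < n := Nat.cast_pos.2 (Nat.pos_of_ne_zero hn)
      rw [← Real.exp_nat_mul, ← Real.le_log_iff_exp_le (hpos' n), mul_comm, ← le_div_iff₀ hn']
      exact hu.lim_le_div hbdd hn
  · have hμ0 : 0 < μ := (Real.exp_pos _).trans hμ
    have hμ1 : 1 ≤ μ := (Real.one_le_exp (ge_of_tendsto' hlim hnn)).trans hμ.le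
    obtain ⟨N, hN⟩ := eventually_atTop.1
      (hlim.eventually_lt_const ((Real.lt_log_iff_exp_lt hμ0).2 hμ))
    refine ⟨1 + ∑ j ∈ Finset.range (N + 1), (s j : ℝ), fun n => ?_⟩
    have hsum : (0 : ℝ) ≤ ∑ j ∈ Finset.range (N + 1), (s j : ℝ) :=
      Finset.sum_nonneg fun j _ => (hpos' j).le
    have hpow : 1 ≤ μ ^ n := one_le_pow₀ hμ1
    rcases Nat.lt_or_ge n (N + 1) with hn | hn
    · have : (s n : ℝ) ≤ ∑ j ∈ Finset.range (N + 1), (s j : ℝ) :=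
        Finset.single_le_sum (f := fun j => (s j : ℝ)) (fun j _ => (hpos' j).le)
          (Finset.mem_range.2 hn)
      nlinarith
    · have hn' : (0 : ℝ) < n := Nat.cast_pos.2 (by omega)
      have h1 := hN n (by omega)
      rw [div_lt_iff₀ hn', mul_comm, ← Real.log_pow,
        Real.log_lt_log_iff (hpos' n) (pow_pos hμ0 n)] at h1
      nlinarith

lemma sum_range_pow_le {lam : ℝ} (h : 1 < lam) (n : ℕ) :
    ∑ j ∈ Finset.range (n + 1), lam ^ j ≤ lam / (lam - 1) * lam ^ n := by
  rw [geom_sum_eq h.ne', div_mul_eq_mul_div, pow_succ']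
  have : 0 < lam - 1 := by linarith
  gcongr
  linarith

/-- A sequence of subexponential growth which is supermultiplicative along its running maxima,
up to a constant, is bounded. -/
lemma le_of_mul_le_mul_partialSups {a : ℕ → ℝ} {C : ℝ} (hC : 0 < C)
    (hpos : ∀ n, 0 < a n) (hgrow : ∀ κ : ℝ, 1 < κ → ∃ A, ∀ n, a n ≤ A * κ ^ n)
    (hmul : ∀ m n, partialSups a m = a m → a n * a m ≤ C * partialSups a (n + m)) (n : ℕ) :
    a n ≤ C := by
  set M := partialSups a
  have hMpos : ∀ n, 0 < M n := fun n => (hpos n).trans_le (le_partialSups a n)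
  have hrec : ∀ n, ∃ k ≤ n, M k = a k ∧ M n = a k := by
    intro n
    obtain ⟨k, hk, hkn⟩ := exists_partialSups_eq a n
    exact ⟨k, hk, le_antisymm (((partialSups a).monotone hk).trans hkn.le) (le_partialSups a k),
      hkn⟩
  have hMmul : ∀ m n, M n * M m ≤ C * M (n + m) := by
    intro m n
    obtain ⟨i, hi, -, hin⟩ := hrec n
    obtain ⟨j, hj, hj', hjm⟩ := hrec m
    rw [hin, hjm]
    refine (hmul j i hj').trans ?_
    gcongr
  have hMpow : ∀ k, M n * (M n / C) ^ k ≤ M ((k + 1) * n) := by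
    intro k
    induction k with
    | zero => simp
    | succ k ih =>
      have h1 := hMmul n ((k + 1) * n)
      rw [← add_one_mul] at h1
      calc M n * (M n / C) ^ (k + 1) = M n * (M n / C) ^ k * M n / C := by
            rw [pow_succ]; ring
        _ ≤ M ((k + 1) * n) * M n / C := by gcongr; exact (hMpos n).le
        _ ≤ M ((k + 1 + 1) * n) := by
            rw [div_le_iff₀ hC]; linarith
  by_contra! hlt
  have hlt' : C < M n := hlt.trans_le (le_partialSups a n)
  obtain ⟨κ, hκ, hκn⟩ := exists_one_lt_pow_lt n ((one_lt_div hC).2 hlt')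
  have hκ0 : 0 < κ := one_pos.trans hκ
  obtain ⟨A, hA⟩ := hgrow κ hκ
  have hA0 : 0 ≤ A := by
    have := (hpos 0).le.trans (hA 0)
    simpa using this
  have hMA : ∀ j, M j ≤ A * κ ^ j := by
    intro j
    obtain ⟨k, hk, -, hkj⟩ := hrec j
    rw [hkj]
    refine (hA k).trans ?_
    gcongr
    exact hκ.le
  refine not_forall_pow_le_mul_pow (A := A * κ ^ n / M n) (pow_pos hκ0 n) hκn fun k => ?_
  have := (hMpow k).trans (hMA _)
  rw [div_mul_eq_mul_div, le_div_iff₀ (hMpos n), ← pow_mul, mul_assoc, ← pow_add]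
  rw [show n + n * k = (k + 1) * n by ring]
  linarith

end Growth

section Counting

variable {G : SimpleGraph V} {S B : V → ℕ → Finset V} {s : ℕ → ℕ}

lemma card_ball_le_sum (hS : ∀ v n y, y ∈ S v n ↔ G.dist v y = n)
    (hB : ∀ v n y, y ∈ B v n ↔ G.dist v y ≤ n) (hs : ∀ v n, (S v n).card = s n) (v : V) (n : ℕ) :
    (B v n).card ≤ ∑ j ∈ Finset.range (n + 1), s j := by
  classical
  calc (B v n).card ≤ ((Finset.range (n + 1)).biUnion (S v)).card :=
        Finset.card_le_card fun y hy => by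
          simp only [Finset.mem_biUnion, Finset.mem_range, hS]
          exact ⟨_, Nat.lt_succ_of_le ((hB v n y).1 hy), rfl⟩
    _ ≤ ∑ j ∈ Finset.range (n + 1), (S v j).card := Finset.card_biUnion_le
    _ = _ := Finset.sum_congr rfl fun j _ => hs v j

lemma card_sphere_add_le [Nonempty V] (hc : G.Connected)
    (hS : ∀ v n y, y ∈ S v n ↔ G.dist v y = n)
    (hs : ∀ v n, (S v n).card = s n) (m n : ℕ) : s (m + n) ≤ s m * s n := by
  classical
  obtain ⟨x⟩ := ‹Nonempty V›
  calc s (m + n) = (S x (m + n)).card := (hs _ _).symm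
    _ ≤ ((S x m).biUnion fun y => S y n).card := Finset.card_le_card fun z hz => by
        rw [hS] at hz
        obtain ⟨w, hw, hw'⟩ := exists_dist_split hc x z (k := m) (by omega)
        simp only [Finset.mem_biUnion, hS]
        exact ⟨w, hw, by omega⟩
    _ ≤ (S x m).card * s n := Finset.card_biUnion_le_card_mul _ _ _ fun y _ => (hs y n).le
    _ = _ := by rw [hs]

/-- The vertices of the sphere of radius `m` about `v` whose Gromov product with `p` is at least
`D + E` lie in a ball of radius `m - E`. -/
lemma exists_center_of_large_product (hc : G.Connected) {D E n m : ℕ} (h4 : FourPoint G D)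
    {v p : V} (hp : G.dist v p = n) :
    ∃ u, ∀ z, G.dist v z = m → G.dist p z + 2 * (D + E) ≤ n + m → G.dist u z + E ≤ m := by
  by_cases hK : D + E ≤ n
  · obtain ⟨u, hu, hu'⟩ := exists_dist_split hc v p (k := D + E) (by omega)
    refine ⟨u, fun z hz hpz => ?_⟩
    have := h4 u v z p
    have c1 := G.dist_comm (u := u) (v := v)
    have c2 := G.dist_comm (u := z) (v := p)
    omega
  · refine ⟨v, fun z hz hpz => ?_⟩
    have t1 := hc.dist_triangle (u := v) (v := p) (w := z)
    omega

/-- If from every vertex at least half of the sphere of radius `m` has small Gromov product with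
any given vertex at distance `n`, then sphere sizes are almost supermultiplicative at `(n, m)`. -/
lemma card_mul_card_le [Nonempty V] {D K n m b : ℕ} (h4 : FourPoint G D)
    (hS : ∀ v n y, y ∈ S v n ↔ G.dist v y = n)
    (hB : ∀ v n y, y ∈ B v n ↔ G.dist v y ≤ n) (hs : ∀ v n, (S v n).card = s n)
    (hc : G.Connected) (hb : ∀ v, (B v (2 * K + D)).card ≤ b)
    (hgood : ∀ v p, G.dist v p = n →
      s m ≤ 2 * {z ∈ S v m | n + m < G.dist p z + 2 * K}.card) :
    ∃ x, s n * s m ≤ 2 * (b * (B x (n + m)).card) := by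
  classical
  obtain ⟨x⟩ := ‹Nonempty V›
  refine ⟨x, ?_⟩
  let r : V → V → Prop := fun y w => G.dist y w = m ∧ n + m < G.dist x w + 2 * K
  have hdc := Finset.sum_card_bipartiteAbove_eq_sum_card_bipartiteBelow
    (s := S x n) (t := B x (n + m)) r
  have hlow : ∀ y ∈ S x n, s m ≤ 2 * ((B x (n + m)).bipartiteAbove r y).card := by
    intro y hy
    rw [hS] at hy
    refine (hgood y x (by rw [dist_comm, hy])).trans ?_
    gcongr
    intro w hw
    rw [Finset.mem_filter, hS] at hw
    rw [Finset.mem_bipartiteAbove, hB]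
    have := hc.dist_triangle (u := x) (v := y) (w := w)
    exact ⟨by omega, hw⟩
  have hup : ∀ w ∈ B x (n + m), ((S x n).bipartiteBelow r w).card ≤ b := by
    intro w _
    rcases ((S x n).bipartiteBelow r w).eq_empty_or_nonempty with h | ⟨y, hy⟩
    · simp [h]
    · refine (Finset.card_le_card fun y' hy' => ?_).trans (hb y)
      rw [Finset.mem_bipartiteBelow, hS] at hy hy'
      obtain ⟨h1, h2, h3⟩ := hy
      obtain ⟨h1', h2', h3'⟩ := hy'
      rw [hB]
      have := h4 x y w y'
      have c1 := G.dist_comm (u := w) (v := y')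
      omega
  calc s n * s m = ∑ _y ∈ S x n, s m := by rw [Finset.sum_const, smul_eq_mul, hs]
    _ ≤ ∑ y ∈ S x n, 2 * ((B x (n + m)).bipartiteAbove r y).card := Finset.sum_le_sum hlow
    _ = 2 * ∑ w ∈ B x (n + m), ((S x n).bipartiteBelow r w).card := by
        rw [← Finset.mul_sum, hdc]
    _ ≤ 2 * ∑ _w ∈ B x (n + m), b := by gcongr with w hw; exact hup w hw
    _ = _ := by rw [Finset.sum_const, smul_eq_mul, mul_comm b]

/-- Spheres of a hyperbolic graph, all of whose spheres of a given radius have the same size,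
grow purely exponentially as soon as the growth rate exceeds one. -/
lemma exists_card_sphere_le [Nonempty V] (hc : G.Connected) {D : ℕ} (h4 : FourPoint G D)
    (hS : ∀ v n y, y ∈ S v n ↔ G.dist v y = n)
    (hB : ∀ v n y, y ∈ B v n ↔ G.dist v y ≤ n) (hs : ∀ v n, (S v n).card = s n)
    {lam : ℝ} (hlam : 1 < lam) (hlow : ∀ n, lam ^ n ≤ s n)
    (hup : ∀ μ, lam < μ → ∃ C : ℝ, ∀ n, (s n : ℝ) ≤ C * μ ^ n) :
    ∃ C : ℝ, ∀ n, (s n : ℝ) ≤ C * lam ^ n := by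
  classical
  have hlam0 : 0 < lam := one_pos.trans hlam
  set c := lam / (lam - 1)
  have hc0 : 0 < c := div_pos hlam0 (sub_pos.2 hlam)
  set a : ℕ → ℝ := fun n => s n / lam ^ n with ha
  have hsa : ∀ n, (s n : ℝ) = a n * lam ^ n := fun n =>
    (div_mul_cancel₀ _ (pow_pos hlam0 n).ne').symm
  have hapos : ∀ n, 0 < a n := fun n =>
    div_pos ((pow_pos hlam0 n).trans_le (hlow n)) (pow_pos hlam0 n)
  have hMpos : ∀ n, 0 < partialSups a n := fun n => (hapos n).trans_le (le_partialSups a n)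
  have hball : ∀ v n, ((B v n).card : ℝ) ≤ partialSups a n * (c * lam ^ n) := by
    intro v n
    calc ((B v n).card : ℝ) ≤ ∑ j ∈ Finset.range (n + 1), (s j : ℝ) := by
          exact_mod_cast card_ball_le_sum hS hB hs v n
      _ ≤ ∑ j ∈ Finset.range (n + 1), partialSups a n * lam ^ j := by
          refine Finset.sum_le_sum fun j hj => ?_
          rw [hsa]
          gcongr
          exact le_partialSups_of_le a (Finset.mem_range_succ_iff.1 hj)
      _ ≤ _ := by
          rw [← Finset.mul_sum]
          gcongr
          · exact (hMpos n).le
          · exact sum_range_pow_le hlam n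
  obtain ⟨E, hE⟩ := pow_unbounded_of_one_lt (2 * c) hlam
  set K := D + E
  set b : ℕ := ∑ j ∈ Finset.range (2 * K + D + 1), s j
  have hb0 : (0 : ℝ) < b + 1 := by positivity
  have hgood : ∀ n m, partialSups a m = a m → ∀ v p, G.dist v p = n →
      s m ≤ 2 * {z ∈ S v m | n + m < G.dist p z + 2 * K}.card := by
    intro n m hm v p hp
    obtain ⟨u, hu⟩ := exists_center_of_large_product hc (E := E) (m := m) h4 hp
    have hsplit := Finset.card_filter_add_card_filter_not (s := S v m)
      (fun z => n + m < G.dist p z + 2 * K)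
    rw [hs] at hsplit
    suffices hbad : 2 * {z ∈ S v m | ¬ n + m < G.dist p z + 2 * K}.card ≤ s m by omega
    by_cases hEm : E ≤ m
    · have hsub : {z ∈ S v m | ¬ n + m < G.dist p z + 2 * K}.card ≤ (B u (m - E)).card := by
        refine Finset.card_le_card fun z hz => ?_
        rw [Finset.mem_filter, hS] at hz
        have := hu z hz.1 (by omega)
        rw [hB]
        omega
      have h1 : (({z ∈ S v m | ¬ n + m < G.dist p z + 2 * K}.card : ℕ) : ℝ) ≤
          a m * (c * lam ^ (m - E)) := by
        refine (Nat.cast_le.2 hsub).trans ((hball u (m - E)).trans ?_)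
        rw [← hm]
        exact mul_le_mul_of_nonneg_right ((partialSups a).monotone (Nat.sub_le m E))
          (by positivity)
      have h2 : 2 * (({z ∈ S v m | ¬ n + m < G.dist p z + 2 * K}.card : ℕ) : ℝ) ≤ s m := by
        calc _ ≤ 2 * (a m * (c * lam ^ (m - E))) := by gcongr
          _ = a m * (2 * c) * lam ^ (m - E) := by ring
          _ ≤ a m * lam ^ E * lam ^ (m - E) := by
              gcongr
          _ = s m := by rw [mul_assoc, ← pow_add, Nat.add_sub_cancel' hEm, hsa]
      exact_mod_cast h2
    · rw [Finset.filter_false_of_mem]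
      · simp
      · intro z hz
        rw [hS] at hz
        have := hu z hz
        omega
  refine ⟨2 * ((b + 1) * c), fun n => ?_⟩
  rw [hsa]
  gcongr
  refine le_of_mul_le_mul_partialSups (a := a) (by positivity) hapos (fun κ hκ => ?_)
    (fun m n hm => ?_) n
  · obtain ⟨A, hA⟩ := hup (lam * κ) (lt_mul_of_one_lt_right hlam0 hκ)
    refine ⟨A, fun n => ?_⟩
    rw [ha]
    beta_reduce
    rw [div_le_iff₀ (pow_pos hlam0 n), mul_assoc, ← mul_pow, mul_comm κ]
    exact hA n
  · obtain ⟨x, hx⟩ := card_mul_card_le h4 hS hB hs hc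
      (fun v => card_ball_le_sum hS hB hs v (2 * K + D)) (hgood n m hm)
    have hx' : (s n : ℝ) * s m ≤ 2 * (b * (B x (n + m)).card) := by exact_mod_cast hx
    rw [hsa, hsa] at hx'
    refine le_of_mul_le_mul_right ?_ (pow_pos hlam0 (n + m))
    calc a n * a m * lam ^ (n + m) = a n * lam ^ n * (a m * lam ^ m) := by rw [pow_add]; ring
      _ ≤ 2 * (b * (B x (n + m)).card) := hx'
      _ ≤ 2 * ((b + 1) * (partialSups a (n + m) * (c * lam ^ (n + m)))) := by
          refine mul_le_mul_of_nonneg_left ?_ zero_le_two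
          exact mul_le_mul (by linarith) (hball x (n + m)) (Nat.cast_nonneg _) hb0.le
      _ = _ := by ring

lemma one_lt_of_forall_isTripodCenter [Nonempty V] (hc : G.Connected) {D K L : ℕ}
    (h4 : FourPoint G D) (hL : K + 2 * D < L) (hT : ∀ v, IsTripodCenter G K L v)
    (hS : ∀ v n y, y ∈ S v n ↔ G.dist v y = n)
    (hB : ∀ v n y, y ∈ B v n ↔ G.dist v y ≤ n) (hs : ∀ v n, (S v n).card = s n)
    {lam : ℝ} (hup : ∀ μ, lam < μ → ∃ C : ℝ, ∀ n, (s n : ℝ) ≤ C * μ ^ n) : 1 < lam := by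
  obtain ⟨x⟩ := ‹Nonempty V›
  by_contra! hle
  obtain ⟨μ, hμ, hμL⟩ := exists_one_lt_pow_lt L (one_lt_two (α := ℝ))
  have hμ0 : 0 < μ := one_pos.trans hμ
  obtain ⟨C, hC⟩ := hup μ (hle.trans_lt hμ)
  have hC0 : 0 ≤ C := by
    have := (Nat.cast_nonneg (s 0)).trans (hC 0)
    simpa using this
  refine not_forall_pow_le_mul_pow (A := C * (μ / (μ - 1))) (pow_pos hμ0 L) hμL fun k => ?_
  obtain ⟨T, hT, hT'⟩ := exists_finset_card_eq_two_pow hc h4 hL hT k x x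
  calc (2 : ℝ) ^ k = T.card := by rw [hT]; norm_cast
    _ ≤ (B x (k * L)).card := by
        exact_mod_cast Finset.card_le_card fun t ht => (hB _ _ _).2 (hT' t ht).1
    _ ≤ ∑ j ∈ Finset.range (k * L + 1), (s j : ℝ) := by
        exact_mod_cast card_ball_le_sum hS hB hs x (k * L)
    _ ≤ ∑ j ∈ Finset.range (k * L + 1), C * μ ^ j := Finset.sum_le_sum fun j _ => hC j
    _ ≤ C * (μ / (μ - 1) * μ ^ (k * L)) := by
        rw [← Finset.mul_sum]
        gcongr
        exact sum_range_pow_le hμ _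
    _ = _ := by rw [mul_comm k, pow_mul, mul_assoc]

end Counting

/-- for a nonelementary δ-hyperbolike graph the spheres `X_{=n}` also
grow like `λⁿ`, with the same `λ` as in the corresponding estimate for balls. -/
theorem exponential_growth_spheres {V : Type*} (G : SimpleGraph V) (δ : ℝ)
    (hG : Hyperbolike G δ) (x : V) (hne : Nonelementary G) :
    ∃ lam : ℝ, 1 < lam ∧
      (∃ C : ℝ, 1 < C ∧ ∀ n : ℕ,
        C⁻¹ * lam^n ≤ (Nat.card {y : V | G.dist x y = n} : ℝ) ∧
        (Nat.card {y : V | G.dist x y = n} : ℝ) ≤ C * lam^n) ∧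
      (∃ C' : ℝ, 1 < C' ∧ ∀ n : ℕ,
        C'⁻¹ * lam^n ≤ (Nat.card (ball G x n) : ℝ) ∧
        (Nat.card (ball G x n) : ℝ) ≤ C' * lam^n) := by
  classical
  obtain ⟨hc, hv, -, hyp, ht⟩ := hG
  obtain ⟨hinf, hqi⟩ := hne
  have : Nonempty V := ⟨x⟩
  have hfin := finite_ball hc hv
  have h4 := IsDeltaHyperbolic.fourPoint hc hyp
  set D := 6 * ⌊δ⌋₊ + 4
  let B : V → ℕ → Finset V := fun v n => (hfin v n).toFinset
  have hB : ∀ v n y, y ∈ B v n ↔ G.dist v y ≤ n := fun v n y => (hfin v n).mem_toFinset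
  let S : V → ℕ → Finset V := fun v n => {y ∈ B v n | G.dist v y = n}
  have hS : ∀ v n y, y ∈ S v n ↔ G.dist v y = n := fun v n y => by
    rw [Finset.mem_filter, hB]
    exact ⟨fun h => h.2, fun h => ⟨h.le, h⟩⟩
  have hs : ∀ v n, (S v n).card = (S x n).card := fun v n => by
    obtain ⟨φ, hφ⟩ := ht x v
    refine (Finset.card_equiv φ.toEquiv fun y => ?_).symm
    rw [hS, hS, ← hφ]
    exact (dist_map_iso hc φ x y).symm ▸ Iff.rfl
  have hSn : ∀ n, Nat.card {y : V | G.dist x y = n} = (S x n).card := fun n =>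
    Nat.subtype_card (S x n) (hS x n)
  have hBn : ∀ n, Nat.card (ball G x n) = (B x n).card := fun n =>
    Nat.card_eq_card_finite_toFinset (hfin x n)
  obtain ⟨lam, -, hlow, hup⟩ := exists_growth_rate (s := fun n => (S x n).card)
    (fun n => by
      obtain ⟨y, hy⟩ := exists_dist_eq hc hfin x n
      exact Finset.card_pos.2 ⟨y, (hS _ _ _).2 hy⟩)
    (card_sphere_add_le hc hS hs)
  have htripod : ∃ v, IsTripodCenter G (D + 1) (3 * D + 2) v := by
    by_contra! h
    exact hqi (quasiIsometricToReal_of_forall_not_isTripodCenter hc hfin ht h4 h)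
  obtain ⟨o, ho⟩ := htripod
  have hT : ∀ v, IsTripodCenter G (D + 1) (3 * D + 2) v := fun v => by
    obtain ⟨φ, rfl⟩ := ht o v
    exact ho.map_iso hc φ
  have hlam := one_lt_of_forall_isTripodCenter hc h4 (by omega) hT hS hB hs hup
  have hlam0 : 0 < lam := one_pos.trans hlam
  obtain ⟨C, hC⟩ := exists_card_sphere_le hc h4 hS hB hs hlam hlow hup
  have hC1 : 1 ≤ C := by simpa using (hlow 0).trans (hC 0)
  have hinv : ∀ A : ℝ, 1 < A → ∀ n, A⁻¹ * lam ^ n ≤ lam ^ n := fun A hA n =>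
    mul_le_of_le_one_left (pow_pos hlam0 n).le (inv_le_one_of_one_le₀ hA.le)
  have hfac : 1 < lam / (lam - 1) := (one_lt_div (sub_pos.2 hlam)).2 (by linarith)
  have hA : 1 < C * (lam / (lam - 1)) := one_lt_mul_of_le_of_lt hC1 hfac
  refine ⟨lam, hlam, ⟨C + 1, by linarith, fun n => ?_⟩, C * (lam / (lam - 1)), hA, fun n => ?_⟩
  · rw [hSn]
    refine ⟨(hinv _ (by linarith) n).trans (hlow n), (hC n).trans ?_⟩
    gcongr
    linarith
  · rw [hBn]
    refine ⟨(hinv _ hA n).trans ((hlow n).trans ?_), ?_⟩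
    · exact_mod_cast Finset.card_le_card (Finset.filter_subset _ (B x n))
    · calc ((B x n).card : ℝ) ≤ ∑ j ∈ Finset.range (n + 1), ((S x j).card : ℝ) := by
            exact_mod_cast card_ball_le_sum hS hB hs x n
        _ ≤ ∑ j ∈ Finset.range (n + 1), C * lam ^ j := Finset.sum_le_sum fun j _ => hC j
        _ ≤ C * (lam / (lam - 1) * lam ^ n) := by
            rw [← Finset.mul_sum]
            gcongr
            exact sum_range_pow_le hlam n
        _ = _ := by rw [mul_assoc]

end CF
end

section
/- (Finiteness of opposite series.) Let X be a δ-hyperbolike graph with base vertex x which is nonelementary (X is infinite and not quasi-isometric to a point or a line), and let Y be a finite connected graph which embeds as a complete subgraph of X_m for some m (so that (Y|X_n) > 0 for all n ≥ m). Then the set Ω(b_Y) of opposite series of the generating function b_Y(t) = Σ_{n≥m} (Y|X_n) tⁿ is finite. -/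
open SimpleGraph Filter

namespace CF

open scoped Topology

section Growth

open PowerSeries

/-- The coefficients of `F` are absolutely summable. -/
def SummableCoeff (F : PowerSeries ℝ) : Prop := Summable fun n => |coeff n F|

/-- The `n`-th coefficient of `F` is `o(n ^ d)`. -/
def LittleOPow (d : ℕ) (F : PowerSeries ℝ) : Prop :=
  Tendsto (fun n : ℕ => coeff n F / ((n : ℝ) + 1) ^ d) atTop (𝓝 0)

/-- The `n`-th coefficient of `F` is `O(n ^ d)`. -/
def BigOPow (d : ℕ) (F : PowerSeries ℝ) : Prop :=
  ∃ M, ∀ n : ℕ, |coeff n F| ≤ M * ((n : ℝ) + 1) ^ d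

/-- The `n`-th coefficient of `F` is `c n * n ^ d + o(n ^ d)` with `c` periodic of period `p`. -/
def PeriodicGrowth (d p : ℕ) (c : ℕ → ℝ) (F : PowerSeries ℝ) : Prop :=
  (∀ n, c (n + p) = c n) ∧
    Tendsto (fun n : ℕ => coeff n F / ((n : ℝ) + 1) ^ d - c n) atTop (𝓝 0)

lemma exists_bound_of_periodic {p : ℕ} (hp : 0 < p) {c : ℕ → ℝ} (hc : ∀ n, c (n + p) = c n) :
    ∃ B, ∀ n, |c n| ≤ B := by
  refine ⟨∑ i ∈ Finset.range p, |c i|, fun n => ?_⟩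
  have hper : Function.Periodic c p := hc
  rw [← hper.map_mod_nat n]
  exact Finset.single_le_sum (f := fun i => |c i|) (fun i _ => abs_nonneg _)
    (Finset.mem_range.2 (Nat.mod_lt n hp))

lemma exists_bound_of_tendsto {u : ℕ → ℝ} {l : ℝ} (h : Tendsto u atTop (𝓝 l)) :
    ∃ B, ∀ n, |u n| ≤ B := by
  obtain ⟨B, hB⟩ := h.abs.bddAbove_range
  exact ⟨B, fun n => hB ⟨n, rfl⟩⟩

lemma PeriodicGrowth.bigOPow {d p : ℕ} (hp : 0 < p) {c : ℕ → ℝ} {F : PowerSeries ℝ}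
    (h : PeriodicGrowth d p c F) : BigOPow d F := by
  obtain ⟨B, hB⟩ := exists_bound_of_periodic hp h.1
  obtain ⟨M, hM⟩ := exists_bound_of_tendsto h.2
  refine ⟨M + B, fun n => ?_⟩
  have hpos : 0 < ((n : ℝ) + 1) ^ d := by positivity
  have h1 : |coeff n F / ((n : ℝ) + 1) ^ d| ≤ M + B := by
    have := abs_add_le (coeff n F / ((n : ℝ) + 1) ^ d - c n) (c n)
    rw [sub_add_cancel] at this
    linarith [hB n, hM n]
  rwa [abs_div, abs_of_pos hpos, div_le_iff₀ hpos] at h1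

lemma LittleOPow.periodicGrowth {d : ℕ} {F : PowerSeries ℝ} (h : LittleOPow d F) :
    PeriodicGrowth d 1 (fun _ => 0) F := ⟨fun _ => rfl, by simpa [LittleOPow] using h⟩

lemma tendsto_shift_pow (d k : ℕ) :
    Tendsto (fun n : ℕ => (((n : ℝ) + 1) / (n + k + 1)) ^ d) atTop (𝓝 1) := by
  have h := tendsto_add_mul_div_add_mul_atTop_nhds (1 : ℝ) (k + 1) 1 one_ne_zero
  have := h.pow d
  simp only [div_one, one_pow] at this
  refine this.congr fun n => ?_
  congr 2 <;> ring

/-- Multiplying by a series with summable coefficients preserves periodic growth. -/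
lemma PeriodicGrowth.mul {d p : ℕ} (hp : 0 < p) {c : ℕ → ℝ} {F G : PowerSeries ℝ}
    (h : PeriodicGrowth d p c F) (hG : SummableCoeff G) :
    PeriodicGrowth d p (fun n => ∑' k, coeff k G * c (n + (p - 1) * k)) (G * F) := by
  obtain ⟨B, hB⟩ := exists_bound_of_periodic hp h.1
  obtain ⟨M, hM⟩ := h.bigOPow hp
  have hper : ∀ k n, c (n + p * k) = c n := by
    intro k n
    induction k with
    | zero => simp
    | succ k ih => rw [Nat.mul_succ, ← add_assoc, h.1, ih]
  have hB0 : 0 ≤ B := (abs_nonneg _).trans (hB 0)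
  have hM0 : 0 ≤ M := by
    have := (abs_nonneg _).trans (hM 0)
    simpa using this
  refine ⟨fun n => by simp only [add_right_comm n p, h.1], ?_⟩
  set T : ℕ → ℕ → ℝ := fun n k =>
    (if k ≤ n then coeff k G * coeff (n - k) F / ((n : ℝ) + 1) ^ d else 0)
      - coeff k G * c (n + (p - 1) * k) with hT
  have hmain : Tendsto (fun n => ∑' k, T n k) atTop (𝓝 (∑' _ : ℕ, (0 : ℝ))) := by
    refine tendsto_tsum_of_dominated_convergence (bound := fun k => |coeff k G| * (M + B))
      (Summable.mul_right _ hG) ?_ ?_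
    · intro k
      rw [← tendsto_add_atTop_iff_nat k]
      obtain hq := tendsto_shift_pow d k
      have h1 := ((h.2.mul hq).const_mul (coeff k G))
      have h2 : Tendsto (fun n : ℕ => coeff k G *
          (c n * ((((n : ℝ) + 1) / (n + k + 1)) ^ d - 1))) atTop (𝓝 0) := by
        have hq' : Tendsto (fun n : ℕ => (((n : ℝ) + 1) / (n + k + 1)) ^ d - 1) atTop (𝓝 0) := by
          simpa using hq.sub_const 1
        have : Tendsto (fun n : ℕ => c n * ((((n : ℝ) + 1) / (n + k + 1)) ^ d - 1)) atTop
            (𝓝 0) := by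
          refine squeeze_zero_norm (a := fun n : ℕ =>
            B * |(((n : ℝ) + 1) / (n + k + 1)) ^ d - 1|) (fun n => ?_) ?_
          · rw [norm_mul]
            exact mul_le_mul_of_nonneg_right (hB n) (norm_nonneg _)
          · simpa using hq'.abs.const_mul B
        simpa using this.const_mul (coeff k G)
      have h3 := h1.add h2
      simp only [zero_mul, mul_zero, add_zero] at h3
      refine h3.congr fun n => ?_
      have e : n + k + (p - 1) * k = n + p * k := by
        obtain ⟨q, rfl⟩ := Nat.exists_eq_succ_of_ne_zero hp.ne'
        simp; ring
      simp only [hT, Nat.le_add_left, if_true, Nat.add_sub_cancel, e, hper, Nat.cast_add]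
      have p1 : ((n : ℝ) + 1) ^ d ≠ 0 := by positivity
      have p2 : ((n : ℝ) + k + 1) ^ d ≠ 0 := by positivity
      rw [div_pow]
      field_simp
      ring
    · refine Eventually.of_forall fun n k => ?_
      have hpos : 0 < ((n : ℝ) + 1) ^ d := by positivity
      have hc := hB (n + (p - 1) * k)
      rw [Real.norm_eq_abs, mul_add]
      refine (abs_sub _ _).trans (add_le_add ?_ ?_)
      · split_ifs with hk
        · rw [abs_div, abs_mul, abs_of_pos hpos, mul_div_assoc]
          refine mul_le_mul_of_nonneg_left ?_ (abs_nonneg _)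
          rw [div_le_iff₀ hpos]
          refine (hM _).trans (mul_le_mul_of_nonneg_left ?_ hM0)
          gcongr
          simp
        · simp only [abs_zero]; positivity
      · rw [abs_mul]
        exact mul_le_mul_of_nonneg_left hc (abs_nonneg _)
  rw [tsum_zero] at hmain
  refine hmain.congr fun n => ?_
  have hs1 : HasSum (fun k => if k ≤ n then coeff k G * coeff (n - k) F / ((n : ℝ) + 1) ^ d else 0)
      (coeff n (G * F) / ((n : ℝ) + 1) ^ d) := by
    rw [coeff_mul, Finset.Nat.sum_antidiagonal_eq_sum_range_succ
      (fun i j => coeff i G * coeff j F), Finset.sum_div]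
    have : ∑ k ∈ Finset.range n.succ, coeff k G * coeff (n - k) F / ((n : ℝ) + 1) ^ d
        = ∑ k ∈ Finset.range n.succ,
          (if k ≤ n then coeff k G * coeff (n - k) F / ((n : ℝ) + 1) ^ d else 0) := by
      refine Finset.sum_congr rfl fun k hk => ?_
      rw [if_pos (Nat.lt_succ_iff.1 (Finset.mem_range.1 hk))]
    rw [this]
    refine hasSum_sum_of_ne_finset_zero fun k hk => ?_
    rw [if_neg]
    simpa [Nat.lt_succ_iff] using hk
  have hs2 : Summable fun k => coeff k G * c (n + (p - 1) * k) := by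
    refine Summable.of_norm_bounded (g := fun k => |coeff k G| * B) (hG.mul_right _) fun k => ?_
    rw [norm_mul]
    exact mul_le_mul_of_nonneg_left (hB _) (abs_nonneg _)
  rw [(hs1.sub hs2.hasSum).tsum_eq]

lemma LittleOPow.mul_summable {d : ℕ} {F G : PowerSeries ℝ} (h : LittleOPow d F)
    (hG : SummableCoeff G) : LittleOPow d (G * F) := by
  simpa [LittleOPow] using (h.periodicGrowth.mul one_pos hG).2

lemma LittleOPow.add {d : ℕ} {F G : PowerSeries ℝ} (hF : LittleOPow d F) (hG : LittleOPow d G) :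
    LittleOPow d (F + G) := by
  have := Tendsto.add hF hG
  rw [add_zero] at this
  exact this.congr fun n => by rw [map_add, add_div]

lemma BigOPow.littleOPow {d e : ℕ} (hde : d < e) {F : PowerSeries ℝ} (h : BigOPow d F) :
    LittleOPow e F := by
  obtain ⟨M, hM⟩ := h
  refine squeeze_zero_norm (a := fun n : ℕ => M * (1 / ((n : ℝ) + 1))) (fun n => ?_) ?_
  · have hpos : 0 < ((n : ℝ) + 1) ^ e := by positivity
    have hM0 : 0 ≤ M := by
      have := (abs_nonneg _).trans (hM 0)
      simpa using this
    rw [Real.norm_eq_abs, abs_div, abs_of_pos hpos, div_le_iff₀ hpos]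
    refine (hM n).trans ?_
    rw [mul_assoc]
    refine mul_le_mul_of_nonneg_left ?_ hM0
    obtain ⟨k, rfl⟩ := Nat.exists_eq_add_of_lt hde
    have : ((n : ℝ) + 1) ^ (d + k + 1) = ((n : ℝ) + 1) * (((n : ℝ) + 1) ^ (d + k)) := by ring
    rw [this, ← mul_assoc, one_div, inv_mul_cancel₀ (by positivity), one_mul]
    gcongr
    · linarith [Nat.cast_nonneg (α := ℝ) n]
    · omega
  · simpa using tendsto_one_div_add_atTop_nhds_zero_nat.const_mul M

lemma SummableCoeff.littleOPow {d : ℕ} {F : PowerSeries ℝ} (h : SummableCoeff F) :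
    LittleOPow d F := by
  have h0 := h.tendsto_atTop_zero
  refine squeeze_zero_norm (fun n => ?_) h0
  have hpos : 1 ≤ ((n : ℝ) + 1) ^ d := one_le_pow₀ (by linarith [Nat.cast_nonneg (α := ℝ) n])
  rw [Real.norm_eq_abs, abs_div, abs_of_pos (one_pos.trans_le hpos)]
  exact div_le_self (abs_nonneg _) hpos

lemma LittleOPow.mul_bigOPow {d e : ℕ} {F G : PowerSeries ℝ} (hF : LittleOPow d F)
    (hG : BigOPow e G) : LittleOPow (d + e + 1) (F * G) := by
  obtain ⟨M, hM⟩ := hG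
  have hM0 : 0 ≤ M := by
    have := (abs_nonneg _).trans (hM 0)
    simpa using this
  have hces := (hF.abs.cesaro.comp (tendsto_add_atTop_nat 1)).const_mul M
  rw [abs_zero, mul_zero] at hces
  refine squeeze_zero_norm (fun n => ?_) hces
  have hn : (0 : ℝ) < (n : ℝ) + 1 := by positivity
  have hpos : 0 < ((n : ℝ) + 1) ^ (d + e + 1) := by positivity
  rw [Real.norm_eq_abs, abs_div, abs_of_pos hpos, div_le_iff₀ hpos, coeff_mul,
    Finset.Nat.sum_antidiagonal_eq_sum_range_succ (fun i j => coeff i F * coeff j G)]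
  have hR : M * ((fun n : ℕ => (n : ℝ)⁻¹ * ∑ i ∈ Finset.range n,
      |coeff i F / ((i : ℝ) + 1) ^ d|) ∘ fun a => a + 1) n * ((n : ℝ) + 1) ^ (d + e + 1)
      = ∑ i ∈ Finset.range n.succ,
        |coeff i F / ((i : ℝ) + 1) ^ d| * (M * ((n : ℝ) + 1) ^ (d + e)) := by
    rw [← Finset.sum_mul]
    simp only [Function.comp_apply, Nat.cast_add, Nat.cast_one, Nat.succ_eq_add_one, pow_succ]
    field_simp
  rw [hR]
  refine (Finset.abs_sum_le_sum_abs _ _).trans (Finset.sum_le_sum fun i hi => ?_)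
  have hi' : i ≤ n := Nat.lt_succ_iff.1 (Finset.mem_range.1 hi)
  have hipos : 0 < ((i : ℝ) + 1) ^ d := by positivity
  rw [abs_mul, abs_div, abs_of_pos hipos, div_mul_eq_mul_div, mul_div_assoc]
  refine mul_le_mul_of_nonneg_left ?_ (abs_nonneg _)
  rw [le_div_iff₀ hipos, pow_add]
  calc |coeff (n - i) G| * ((i : ℝ) + 1) ^ d
      ≤ (M * (((n - i : ℕ) : ℝ) + 1) ^ e) * ((i : ℝ) + 1) ^ d :=
        mul_le_mul_of_nonneg_right (hM _) hipos.le
    _ ≤ (M * ((n : ℝ) + 1) ^ e) * ((n : ℝ) + 1) ^ d := by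
        gcongr
        exact Nat.sub_le n i
    _ = M * (((n : ℝ) + 1) ^ d * ((n : ℝ) + 1) ^ e) := by ring

lemma SummableCoeff.mul {F G : PowerSeries ℝ} (hF : SummableCoeff F) (hG : SummableCoeff G) :
    SummableCoeff (F * G) := by
  have := summable_norm_sum_mul_antidiagonal_of_summable_norm
    (f := fun n => coeff n F) (g := fun n => coeff n G) hF hG
  refine this.congr fun n => ?_
  rw [coeff_mul, Real.norm_eq_abs]

lemma SummableCoeff.add {F G : PowerSeries ℝ} (hF : SummableCoeff F) (hG : SummableCoeff G) :
    SummableCoeff (F + G) := by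
  refine Summable.of_nonneg_of_le (fun _ => abs_nonneg _) (fun n => ?_) (Summable.add hF hG)
  rw [map_add]
  exact abs_add_le _ _

lemma summableCoeff_coe (P : Polynomial ℝ) : SummableCoeff (P : PowerSeries ℝ) := by
  refine summable_of_ne_finset_zero (s := Finset.range (P.natDegree + 1)) fun n hn => ?_
  rw [Polynomial.coeff_coe, Polynomial.coeff_eq_zero_of_natDegree_lt, abs_zero]
  simpa [Nat.lt_succ_iff] using hn

/-- The series `∑ X ^ (p * k)`. -/
noncomputable def periodicOnes (p : ℕ) : PowerSeries ℝ := mk fun n => if p ∣ n then 1 else 0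

lemma periodicOnes_eq_expand {p : ℕ} (hp : p ≠ 0) :
    periodicOnes p = expand p hp (mk 1 : PowerSeries ℝ) := by
  ext n
  simp [periodicOnes, coeff_expand]

lemma periodicOnes_mul_one_sub {p : ℕ} (hp : p ≠ 0) :
    periodicOnes p * (1 - PowerSeries.X ^ p) = 1 := by
  have := congrArg (expand p hp) (mk_one_mul_one_sub_eq_one ℝ)
  rwa [map_mul, map_sub, map_one, expand_X, ← periodicOnes_eq_expand hp] at this

lemma periodicOnes_eq_mul {p q : ℕ} (hp : p ≠ 0) (hq : q ≠ 0) :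
    periodicOnes p = (∑ i ∈ Finset.range q, (PowerSeries.X ^ p) ^ i) * periodicOnes (p * q) := by
  have h1 := periodicOnes_mul_one_sub (mul_ne_zero hp hq)
  have h2 := periodicOnes_mul_one_sub hp
  have h3 := geom_sum_mul_neg (PowerSeries.X ^ p : PowerSeries ℝ) q
  rw [← pow_mul] at h3
  calc periodicOnes p
    _ = periodicOnes p * (periodicOnes (p * q) * (1 - PowerSeries.X ^ (p * q))) := by
      rw [h1, mul_one]
    _ = (periodicOnes p * (1 - PowerSeries.X ^ p)) *
        ((∑ i ∈ Finset.range q, (PowerSeries.X ^ p) ^ i) * periodicOnes (p * q)) := by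
        rw [← h3]; ring
    _ = _ := by rw [h2, one_mul]

lemma coeff_periodicOnes_pow {p : ℕ} (hp : p ≠ 0) (d n : ℕ) :
    coeff n (periodicOnes p ^ (d + 1)) = if p ∣ n then ((d + n / p).choose d : ℝ) else 0 := by
  rw [periodicOnes_eq_expand hp, ← map_pow, mk_one_pow_eq_mk_choose_add, coeff_expand]
  simp

lemma periodicGrowth_periodicOnes_pow {p : ℕ} (hp : 0 < p) (d : ℕ) :
    PeriodicGrowth d p (fun n => if p ∣ n then ((p : ℝ) ^ d * d.factorial)⁻¹ else 0)
      (periodicOnes p ^ (d + 1)) := by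
  refine ⟨fun n => by simp, ?_⟩
  have hp' : (p : ℝ) ≠ 0 := by positivity
  have h1 : Tendsto (fun m : ℕ => ((d + m).choose d : ℝ) / ((p : ℝ) * m + 1) ^ d
      - ((p : ℝ) ^ d * d.factorial)⁻¹) atTop (𝓝 0) := by
    have hc := (isEquivalent_choose d).comp_tendsto (tendsto_add_atTop_nat d)
    have hne : ∀ᶠ m : ℕ in atTop,
        ((fun n : ℕ => (n : ℝ) ^ d / (d.factorial : ℝ)) ∘ fun a => a + d) m ≠ 0 := by
      filter_upwards [eventually_ge_atTop 1] with m hm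
      have : (0 : ℝ) < ((m + d : ℕ) : ℝ) := by
        exact_mod_cast (by omega : 0 < m + d)
      simp only [Function.comp_apply]
      positivity
    have hc' := (Asymptotics.isEquivalent_iff_tendsto_one hne).1 hc
    have hq := (tendsto_add_mul_div_add_mul_atTop_nhds (d : ℝ) 1 1 hp').pow d
    have hh := (hc'.mul hq).mul_const ((d.factorial : ℝ)⁻¹)
    have hh2 := hh.sub_const (((p : ℝ) ^ d * d.factorial)⁻¹)
    have e0 : 1 * (1 / (p : ℝ)) ^ d * (d.factorial : ℝ)⁻¹ - ((p : ℝ) ^ d * d.factorial)⁻¹ = 0 := by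
      rw [mul_inv, one_div, inv_pow]; ring
    rw [e0] at hh2
    refine hh2.congr' ?_
    filter_upwards [eventually_ge_atTop 1] with m hm
    have hmd : (0 : ℝ) < (m : ℝ) + d := by
      have : (1 : ℝ) ≤ m := by exact_mod_cast hm
      positivity
    have hf : (d.factorial : ℝ) ≠ 0 := by positivity
    have h3 : (0 : ℝ) < 1 + p * m := by positivity
    simp only [Function.comp_apply, Pi.div_apply, Nat.cast_add, one_mul]
    rw [add_comm (d : ℝ) m, add_comm (1 : ℝ), add_comm m d, div_pow]
    congr 1
    field_simp
  refine squeeze_zero_norm (fun n => ?_) (h1.abs.comp (Nat.tendsto_div_const_atTop hp.ne') |>.trans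
    (by rw [abs_zero]))
  rw [coeff_periodicOnes_pow hp.ne']
  by_cases hn : p ∣ n
  · obtain ⟨k, rfl⟩ := hn
    simp [Nat.mul_div_cancel_left k hp]
  · simp [hn]

end Growth

section Regular

open PowerSeries

/-- All coefficients of `F` are nonnegative. -/
def NonnegCoeff (F : PowerSeries ℝ) : Prop := ∀ n, 0 ≤ coeff n F

lemma NonnegCoeff.add {F G : PowerSeries ℝ} (hF : NonnegCoeff F) (hG : NonnegCoeff G) :
    NonnegCoeff (F + G) := fun n => by
  rw [map_add]; exact add_nonneg (hF n) (hG n)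

lemma NonnegCoeff.mul {F G : PowerSeries ℝ} (hF : NonnegCoeff F) (hG : NonnegCoeff G) :
    NonnegCoeff (F * G) := fun n => by
  rw [coeff_mul]; exact Finset.sum_nonneg fun i _ => mul_nonneg (hF _) (hG _)

lemma nonnegCoeff_one : NonnegCoeff 1 := fun n => by
  rw [coeff_one]; split_ifs <;> norm_num

lemma NonnegCoeff.pow {F : PowerSeries ℝ} (hF : NonnegCoeff F) (k : ℕ) : NonnegCoeff (F ^ k) := by
  induction k with
  | zero => rw [pow_zero]; exact nonnegCoeff_one
  | succ k ih => rw [pow_succ]; exact ih.mul hF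

lemma nonnegCoeff_X : NonnegCoeff PowerSeries.X := fun n => by
  rw [coeff_X]; split_ifs <;> norm_num

lemma NonnegCoeff.sum {ι : Type*} (s : Finset ι) {F : ι → PowerSeries ℝ}
    (h : ∀ i ∈ s, NonnegCoeff (F i)) : NonnegCoeff (∑ i ∈ s, F i) := fun n => by
  rw [map_sum]; exact Finset.sum_nonneg fun i hi => h i hi n

lemma NonnegCoeff.exists_pos {F : PowerSeries ℝ} (hF : NonnegCoeff F) (h0 : F ≠ 0) :
    ∃ n, 0 < coeff n F := by
  by_contra! h
  exact h0 (PowerSeries.ext fun n => by rw [map_zero]; exact le_antisymm (h n) (hF n))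

lemma NonnegCoeff.add_ne_zero {F G : PowerSeries ℝ} (hF : NonnegCoeff F) (hG : NonnegCoeff G)
    (h0 : F ≠ 0) : F + G ≠ 0 := by
  obtain ⟨n, hn⟩ := hF.exists_pos h0
  intro h
  have := congrArg (coeff n) h
  rw [map_add, map_zero] at this
  linarith [hG n]

lemma NonnegCoeff.rescale {F : PowerSeries ℝ} (hF : NonnegCoeff F) {r : ℝ} (hr : 0 ≤ r) :
    NonnegCoeff (rescale r F) := fun n => by
  rw [coeff_rescale]; exact mul_nonneg (pow_nonneg hr n) (hF n)

lemma rescale_ne_zero {F : PowerSeries ℝ} (hF : F ≠ 0) {r : ℝ} (hr : r ≠ 0) :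
    PowerSeries.rescale r F ≠ 0 := by
  intro h
  refine hF (PowerSeries.ext fun n => ?_)
  have := congrArg (coeff n) h
  rw [coeff_rescale, map_zero] at this
  rw [map_zero]
  exact (mul_eq_zero.1 this).resolve_left (pow_ne_zero n hr)

/-- Up to `o(n ^ d)`, the coefficients of `F` agree with those of `C * (1 - X ^ p)⁻¹ ^ (d + 1)`,
where `C` is a nonzero series with nonnegative summable coefficients. -/
structure IsLeading (p d : ℕ) (C F : PowerSeries ℝ) : Prop where
  nonneg : NonnegCoeff C
  ne_zero : C ≠ 0
  summable : SummableCoeff C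
  littleO : LittleOPow d (F - C * periodicOnes p ^ (d + 1))

variable {p d e : ℕ} {C D F G : PowerSeries ℝ}

lemma IsLeading.exists_periodicGrowth (hp : 0 < p) (h : IsLeading p d C F) :
    ∃ c : ℕ → ℝ, (∀ n, 0 ≤ c n) ∧ (∃ n, 0 < c n) ∧ PeriodicGrowth d p c F := by
  have hE := periodicGrowth_periodicOnes_pow hp d
  obtain ⟨hper, hlim⟩ := hE.mul hp h.summable
  have hnn : ∀ n k, 0 ≤ coeff k C *
      (if p ∣ n + (p - 1) * k then ((p : ℝ) ^ d * d.factorial)⁻¹ else 0) := by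
    intro n k
    refine mul_nonneg (h.nonneg k) ?_
    split_ifs <;> positivity
  refine ⟨_, fun n => tsum_nonneg (hnn n), ?_, hper, ?_⟩
  · obtain ⟨k, hk⟩ := h.nonneg.exists_pos h.ne_zero
    refine ⟨k, ?_⟩
    have hs : Summable fun j => coeff j C *
        (if p ∣ k + (p - 1) * j then ((p : ℝ) ^ d * d.factorial)⁻¹ else 0) := by
      refine Summable.of_nonneg_of_le (hnn k) (fun j => ?_)
        (Summable.mul_right (((p : ℝ) ^ d * d.factorial)⁻¹) h.summable)
      refine mul_le_mul (le_abs_self _) ?_ (by split_ifs <;> positivity) (abs_nonneg _)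
      split_ifs
      · exact le_rfl
      · positivity
    refine lt_of_lt_of_le ?_ (hs.le_tsum k fun j _ => hnn k j)
    have : k + (p - 1) * k = p * k := by
      obtain ⟨q, rfl⟩ := Nat.exists_eq_succ_of_ne_zero hp.ne'
      simp; ring
    rw [this, if_pos (dvd_mul_right p k)]
    positivity
  · have := hlim.add h.littleO
    rw [add_zero] at this
    refine this.congr fun n => ?_
    rw [map_sub, sub_div]
    ring

lemma IsLeading.bigOPow (hp : 0 < p) (h : IsLeading p d C F) : BigOPow d F := by
  obtain ⟨c, -, -, hc⟩ := h.exists_periodicGrowth hp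
  exact hc.bigOPow hp

lemma IsLeading.add_littleO (h : IsLeading p d C F) (hG : LittleOPow d G) :
    IsLeading p d C (F + G) :=
  ⟨h.nonneg, h.ne_zero, h.summable, by
    have := h.littleO.add hG
    rwa [sub_add_eq_add_sub] at this⟩

lemma IsLeading.add (hF : IsLeading p d C F) (hG : IsLeading p d D G) :
    IsLeading p d (C + D) (F + G) :=
  ⟨hF.nonneg.add hG.nonneg, hF.nonneg.add_ne_zero hG.nonneg hF.ne_zero,
    hF.summable.add hG.summable, by
      have := hF.littleO.add hG.littleO
      rwa [sub_add_sub_comm, ← add_mul] at this⟩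

lemma IsLeading.mul_summable (hF : IsLeading p d C F) (hG : SummableCoeff G)
    (hG' : NonnegCoeff G) (hG0 : G ≠ 0) : IsLeading p d (G * C) (G * F) :=
  ⟨hG'.mul hF.nonneg, mul_ne_zero hG0 hF.ne_zero, hG.mul hF.summable, by
    have := hF.littleO.mul_summable hG
    rwa [mul_sub, ← mul_assoc] at this⟩

lemma IsLeading.mul (hp : 0 < p) (hF : IsLeading p d C F) (hG : IsLeading p e D G) :
    IsLeading p (d + e + 1) (C * D) (F * G) := by
  refine ⟨hF.nonneg.mul hG.nonneg, mul_ne_zero hF.ne_zero hG.ne_zero,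
    hF.summable.mul hG.summable, ?_⟩
  have h1 := hF.littleO.mul_bigOPow (hG.bigOPow hp)
  have h2 := hG.littleO.mul_bigOPow
    (((periodicGrowth_periodicOnes_pow hp d).mul hp hF.summable).bigOPow hp)
  rw [add_comm e d] at h2
  have h3 := h1.add h2
  have e1 : (F - C * periodicOnes p ^ (d + 1)) * G
      + (G - D * periodicOnes p ^ (e + 1)) * (C * periodicOnes p ^ (d + 1))
      = F * G - C * D * periodicOnes p ^ (d + e + 1 + 1) := by ring
  rwa [e1] at h3

lemma IsLeading.mul_period {q : ℕ} (hp : 0 < p) (hq : 0 < q) (h : IsLeading p d C F) :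
    ∃ D, IsLeading (p * q) d D F := by
  set g : PowerSeries ℝ := ∑ i ∈ Finset.range q, (PowerSeries.X ^ p) ^ i with hg
  have hgE : periodicOnes p = g * periodicOnes (p * q) := periodicOnes_eq_mul hp.ne' hq.ne'
  have hg0 : g ≠ 0 := by
    rintro h0
    have := periodicOnes_mul_one_sub hp.ne'
    rw [hgE, h0, zero_mul, zero_mul] at this
    exact zero_ne_one this
  have hgn : NonnegCoeff g := NonnegCoeff.sum _ fun i _ => (nonnegCoeff_X.pow p).pow i
  have hgs : SummableCoeff (g ^ (d + 1)) := by
    have : g ^ (d + 1) =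
        (((∑ i ∈ Finset.range q, (Polynomial.X ^ p) ^ i) ^ (d + 1) : Polynomial ℝ) :
          PowerSeries ℝ) := by
      rw [Polynomial.coe_pow, ← Polynomial.coeToPowerSeries.ringHom_apply, map_sum]
      simp [hg]
    rw [this]
    exact summableCoeff_coe _
  refine ⟨g ^ (d + 1) * C, (hgn.pow _).mul h.nonneg, mul_ne_zero (pow_ne_zero _ hg0) h.ne_zero,
    hgs.mul h.summable, ?_⟩
  have := h.littleO
  rwa [hgE, mul_pow, ← mul_assoc, mul_comm C] at this

/-- After rescaling by `r`, the coefficients of `F` have a periodic polynomial leading term. -/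
def GrowthAt (r : ℝ) (F : PowerSeries ℝ) : Prop :=
  ∃ p d C, 0 < p ∧ IsLeading p d C (rescale r F)

variable {r s : ℝ}

lemma GrowthAt.add_summable (hF : GrowthAt r F) (hG : SummableCoeff (rescale r G)) :
    GrowthAt r (F + G) := by
  obtain ⟨p, d, C, hp, h⟩ := hF
  refine ⟨p, d, C, hp, ?_⟩
  rw [map_add]
  exact h.add_littleO hG.littleOPow

lemma GrowthAt.add (hF : GrowthAt r F) (hG : GrowthAt r G) : GrowthAt r (F + G) := by
  obtain ⟨p, d, C, hp, hC⟩ := hF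
  obtain ⟨q, e, D, hq, hD⟩ := hG
  rcases lt_trichotomy d e with hlt | rfl | hlt
  · refine ⟨q, e, D, hq, ?_⟩
    rw [map_add, add_comm]
    exact hD.add_littleO ((hC.bigOPow hp).littleOPow hlt)
  · obtain ⟨C', hC'⟩ := hC.mul_period hp hq
    obtain ⟨D', hD'⟩ := hD.mul_period hq hp
    rw [mul_comm q p] at hD'
    refine ⟨p * q, d, C' + D', mul_pos hp hq, ?_⟩
    rw [map_add]
    exact hC'.add hD'
  · refine ⟨p, d, C, hp, ?_⟩
    rw [map_add]
    exact hC.add_littleO ((hD.bigOPow hq).littleOPow hlt)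

lemma GrowthAt.mul_summable (hr : 0 < r) (hF : GrowthAt r F) (hG : SummableCoeff (rescale r G))
    (hG' : NonnegCoeff G) (hG0 : G ≠ 0) : GrowthAt r (G * F) := by
  obtain ⟨p, d, C, hp, h⟩ := hF
  refine ⟨p, d, PowerSeries.rescale r G * C, hp, ?_⟩
  rw [map_mul]
  exact h.mul_summable hG (hG'.rescale hr.le) (rescale_ne_zero hG0 hr.ne')

lemma GrowthAt.mul (hF : GrowthAt r F) (hG : GrowthAt r G) : GrowthAt r (F * G) := by
  obtain ⟨p, d, C, hp, hC⟩ := hF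
  obtain ⟨q, e, D, hq, hD⟩ := hG
  obtain ⟨C', hC'⟩ := hC.mul_period hp hq
  obtain ⟨D', hD'⟩ := hD.mul_period hq hp
  rw [mul_comm q p] at hD'
  refine ⟨p * q, d + e + 1, C' * D', mul_pos hp hq, ?_⟩
  rw [map_mul]
  exact hC'.mul (mul_pos hp hq) hD'

lemma GrowthAt.summable_of_lt (hs : 0 < s) (hsr : s < r) (hF : GrowthAt r F) :
    SummableCoeff (rescale s F) := by
  obtain ⟨p, d, C, hp, h⟩ := hF
  obtain ⟨M, hM⟩ := h.bigOPow hp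
  have hr : 0 < r := hs.trans hsr
  have hq : ‖s / r‖ < 1 := by
    rw [Real.norm_of_nonneg (by positivity), div_lt_one hr]; exact hsr
  have hsum : Summable fun n : ℕ => ((n + 1 : ℕ) : ℝ) ^ d * (s / r) ^ (n + 1) :=
    (summable_pow_mul_geometric_of_norm_lt_one d hq).comp_injective (add_left_injective 1)
  refine Summable.of_nonneg_of_le (fun _ => abs_nonneg _) (fun n => ?_)
    (hsum.mul_left (M * (r / s)))
  have h1 : coeff n (rescale s F) = (s / r) ^ n * coeff n (rescale r F) := by
    rw [coeff_rescale, coeff_rescale, ← mul_assoc, ← mul_pow, div_mul_cancel₀ _ hr.ne']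
  have h2 : r / s * (s / r) = 1 := by
    rw [div_mul_div_comm, mul_comm, div_self (mul_pos hs hr).ne']
  have hq0 : 0 < (s / r) ^ n := pow_pos (div_pos hs hr) n
  rw [h1, abs_mul, abs_of_pos hq0]
  calc (s / r) ^ n * |coeff n (rescale r F)| ≤ (s / r) ^ n * (M * ((n : ℝ) + 1) ^ d) :=
        mul_le_mul_of_nonneg_left (hM n) hq0.le
    _ = M * (r / s * (s / r)) * (((n : ℝ) + 1) ^ d * (s / r) ^ n) := by rw [h2]; ring
    _ = _ := by
      rw [pow_succ, Nat.cast_add, Nat.cast_one]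
      ring

lemma GrowthAt.not_summable (hF : GrowthAt r F) : ¬ SummableCoeff (rescale r F) := by
  obtain ⟨p, d, C, hp, h⟩ := hF
  intro hs
  obtain ⟨c, -, ⟨n, hn⟩, hper, hlim⟩ := h.exists_periodicGrowth hp
  have h0 : LittleOPow d (rescale r F) := hs.littleOPow
  have h1 := Tendsto.sub h0 hlim
  simp only [sub_sub_cancel, sub_zero] at h1
  have h2 := h1.comp (tendsto_atTop_mono (f := fun k : ℕ => k) (g := fun k => n + p * k)
    (fun k => by nlinarith) tendsto_id)
  have h3 : ∀ k, c (n + p * k) = c n := by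
    intro k
    induction k with
    | zero => simp
    | succ k ih => rw [Nat.mul_succ, ← add_assoc, hper, ih]
  have h4 : ((fun n => c n) ∘ fun k => n + p * k) = fun _ => c n := funext h3
  rw [h4] at h2
  exact hn.ne' (tendsto_nhds_unique tendsto_const_nhds h2)

/-- A series with nonnegative coefficients which is a polynomial or whose coefficients have
a leading term of the form `c n * n ^ d * r ^ (-n)` with `c` periodic. -/
def RegularGrowth (F : PowerSeries ℝ) : Prop :=
  NonnegCoeff F ∧ ((∃ P : Polynomial ℝ, (P : PowerSeries ℝ) = F) ∨ ∃ r, 0 < r ∧ GrowthAt r F)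

lemma summableCoeff_rescale_coe (r : ℝ) (P : Polynomial ℝ) :
    SummableCoeff (rescale r (P : PowerSeries ℝ)) := by
  refine summable_of_ne_finset_zero (s := Finset.range (P.natDegree + 1)) fun n hn => ?_
  rw [coeff_rescale, Polynomial.coeff_coe, Polynomial.coeff_eq_zero_of_natDegree_lt, mul_zero,
    abs_zero]
  simpa [Nat.lt_succ_iff] using hn

lemma regularGrowth_zero : RegularGrowth 0 :=
  ⟨fun n => by simp, Or.inl ⟨0, Polynomial.coe_zero⟩⟩

lemma regularGrowth_one : RegularGrowth 1 :=
  ⟨nonnegCoeff_one, Or.inl ⟨1, Polynomial.coe_one⟩⟩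

lemma regularGrowth_X : RegularGrowth PowerSeries.X :=
  ⟨nonnegCoeff_X, Or.inl ⟨Polynomial.X, Polynomial.coe_X⟩⟩

lemma regularGrowth_C {a : ℝ} (ha : 0 ≤ a) : RegularGrowth (PowerSeries.C a) :=
  ⟨fun n => by rw [coeff_C]; split_ifs <;> simp [ha], Or.inl ⟨Polynomial.C a, Polynomial.coe_C a⟩⟩

lemma RegularGrowth.add (hF : RegularGrowth F) (hG : RegularGrowth G) : RegularGrowth (F + G) := by
  refine ⟨hF.1.add hG.1, ?_⟩
  rcases hF.2 with ⟨P, rfl⟩ | ⟨r, hr, hF'⟩ <;> rcases hG.2 with ⟨Q, rfl⟩ | ⟨s, hs, hG'⟩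
  · exact Or.inl ⟨P + Q, Polynomial.coe_add P Q⟩
  · refine Or.inr ⟨s, hs, ?_⟩
    rw [add_comm]
    exact hG'.add_summable (summableCoeff_rescale_coe s P)
  · exact Or.inr ⟨r, hr, hF'.add_summable (summableCoeff_rescale_coe r Q)⟩
  · right
    rcases lt_trichotomy r s with h | rfl | h
    · exact ⟨r, hr, hF'.add_summable (hG'.summable_of_lt hr h)⟩
    · exact ⟨r, hr, hF'.add hG'⟩
    · refine ⟨s, hs, ?_⟩
      rw [add_comm]
      exact hG'.add_summable (hF'.summable_of_lt hs h)

lemma RegularGrowth.mul (hF : RegularGrowth F) (hG : RegularGrowth G) : RegularGrowth (F * G) := by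
  rcases eq_or_ne F 0 with rfl | hF0
  · rw [zero_mul]; exact regularGrowth_zero
  rcases eq_or_ne G 0 with rfl | hG0
  · rw [mul_zero]; exact regularGrowth_zero
  refine ⟨hF.1.mul hG.1, ?_⟩
  rcases hF.2 with ⟨P, rfl⟩ | ⟨r, hr, hF'⟩ <;> rcases hG.2 with ⟨Q, rfl⟩ | ⟨s, hs, hG'⟩
  · exact Or.inl ⟨P * Q, Polynomial.coe_mul P Q⟩
  · exact Or.inr ⟨s, hs, hG'.mul_summable hs (summableCoeff_rescale_coe s P) hF.1 hF0⟩
  · refine Or.inr ⟨r, hr, ?_⟩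
    rw [mul_comm]
    exact hF'.mul_summable hr (summableCoeff_rescale_coe r Q) hG.1 hG0
  · right
    rcases lt_trichotomy r s with h | rfl | h
    · refine ⟨r, hr, ?_⟩
      rw [mul_comm]
      exact hF'.mul_summable hr (hG'.summable_of_lt hr h) hG.1 hG0
    · exact ⟨r, hr, hF'.mul hG'⟩
    · exact ⟨s, hs, hG'.mul_summable hs (hF'.summable_of_lt hs h) hF.1 hF0⟩

lemma RegularGrowth.sum {ι : Type*} (s : Finset ι) {F : ι → PowerSeries ℝ}
    (h : ∀ i ∈ s, RegularGrowth (F i)) : RegularGrowth (∑ i ∈ s, F i) := by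
  induction s using Finset.cons_induction with
  | empty => rw [Finset.sum_empty]; exact regularGrowth_zero
  | cons a s ha ih =>
    rw [Finset.sum_cons]
    exact (h a (Finset.mem_cons_self a s)).add
      (ih fun i hi => h i (Finset.mem_cons_of_mem hi))

end Regular

section Renewal

open PowerSeries

lemma coeff_mul_eq_sum_range (F G : PowerSeries ℝ) (n : ℕ) :
    coeff n (F * G) = ∑ k ∈ Finset.range (n + 1), coeff k F * coeff (n - k) G := by
  rw [coeff_mul, Finset.Nat.sum_antidiagonal_eq_sum_range_succ (fun i j => coeff i F * coeff j G)]

variable {f u : PowerSeries ℝ}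

lemma nonnegCoeff_of_eq_one_add_mul (hf : NonnegCoeff f) (h0 : coeff 0 f = 0)
    (hu : u = 1 + f * u) : NonnegCoeff u := by
  intro n
  induction n using Nat.strong_induction_on with
  | _ n ih =>
    rw [hu, map_add, coeff_mul_eq_sum_range]
    refine add_nonneg (nonnegCoeff_one n) (Finset.sum_nonneg fun k hk => ?_)
    rcases Nat.eq_zero_or_pos k with rfl | hk0
    · rw [h0, zero_mul]
    · have := Finset.mem_range.1 hk
      exact mul_nonneg (hf k) (ih _ (by omega))

lemma coeff_eq_zero_of_not_dvd {g : ℕ} (hg : ∀ k, coeff k f ≠ 0 → g ∣ k) (h0 : coeff 0 f = 0)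
    (hu : u = 1 + f * u) {n : ℕ} (hn : ¬ g ∣ n) : coeff n u = 0 := by
  induction n using Nat.strong_induction_on with
  | _ n ih =>
    have hn0 : n ≠ 0 := by rintro rfl; exact hn (dvd_zero g)
    rw [hu, map_add, coeff_mul_eq_sum_range, coeff_one, if_neg hn0, zero_add]
    refine Finset.sum_eq_zero fun k hk => ?_
    have hkn := Finset.mem_range.1 hk
    by_cases hk0 : coeff k f = 0
    · rw [hk0, zero_mul]
    · have hk1 : k ≠ 0 := by rintro rfl; exact hk0 h0
      rw [ih (n - k) (by omega), mul_zero]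
      intro h
      exact hn ((Nat.dvd_sub_iff_left (by omega) (hg k hk0)).1 h)

/-- The series of tails `1 - ∑_{j ≤ n} f j`. -/
noncomputable def tailSeries (f : PowerSeries ℝ) : PowerSeries ℝ :=
  mk fun n => 1 - ∑ j ∈ Finset.range (n + 1), coeff j f

lemma tailSeries_mul_one_sub_X (f : PowerSeries ℝ) :
    tailSeries f * (1 - PowerSeries.X) = 1 - f := by
  ext n
  rw [mul_sub, mul_one, map_sub, map_sub]
  cases n with
  | zero => simp [tailSeries]
  | succ n =>
    rw [coeff_succ_mul_X, tailSeries, coeff_mk, coeff_mk, Finset.sum_range_succ _ (n + 1),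
      coeff_one, if_neg (Nat.succ_ne_zero n)]
    ring

lemma tailSeries_mul (hu : u = 1 + f * u) : tailSeries f * u = PowerSeries.mk 1 := by
  have h1 : (1 - f) * u = 1 := by linear_combination hu
  have h2 : (tailSeries f * u) * (1 - PowerSeries.X) = PowerSeries.mk 1 * (1 - PowerSeries.X) := by
    rw [mk_one_mul_one_sub_eq_one, mul_right_comm, tailSeries_mul_one_sub_X, h1]
  have h3 : (1 - PowerSeries.X : PowerSeries ℝ) ≠ 0 := by
    intro h
    have := congrArg (coeff 0) h
    simp at this
  exact mul_right_cancel₀ h3 h2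

lemma nonnegCoeff_tailSeries (hf : NonnegCoeff f) (h1 : HasSum (fun n => coeff n f) 1) :
    NonnegCoeff (tailSeries f) := fun n => by
  rw [tailSeries, coeff_mk, sub_nonneg]
  exact sum_le_hasSum _ (fun i _ => hf i) h1

lemma summable_tailSeries (hf : NonnegCoeff f) (h1 : HasSum (fun n => coeff n f) 1) {t : ℝ}
    (ht1 : 1 < t) (ht : Summable fun n => coeff n f * t ^ n) :
    Summable fun n => coeff n (tailSeries f) := by
  have ht0 : 0 < t := one_pos.trans ht1
  set M := ∑' n, coeff n f * t ^ n with hM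
  have hgeo : Summable fun n : ℕ => M * (t⁻¹) ^ n :=
    (summable_geometric_of_lt_one (by positivity) (inv_lt_one_of_one_lt₀ ht1)).mul_left M
  refine Summable.of_nonneg_of_le (nonnegCoeff_tailSeries hf h1) (fun n => ?_) hgeo
  have hs := (hasSum_nat_add_iff' (n + 1)).2 h1
  rw [tailSeries, coeff_mk, inv_pow, ← div_eq_mul_inv, le_div_iff₀ (by positivity)]
  have hs' := hs.mul_right (t ^ n)
  have hb : Summable fun k => coeff (k + (n + 1)) f * t ^ (k + (n + 1)) :=
    ht.comp_injective (add_left_injective (n + 1))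
  have hle : ∑' k, coeff (k + (n + 1)) f * t ^ (k + (n + 1)) ≤ M := by
    have := ht.sum_add_tsum_nat_add (n + 1)
    rw [hM, ← this]
    have : 0 ≤ ∑ i ∈ Finset.range (n + 1), coeff i f * t ^ i :=
      Finset.sum_nonneg fun i _ => mul_nonneg (hf i) (by positivity)
    linarith
  refine le_trans (hasSum_le (fun k => ?_) hs' hb.hasSum) hle
  exact mul_le_mul_of_nonneg_left (pow_le_pow_right₀ ht1.le (by omega)) (hf _)

lemma tendsto_conv_of_tendsto_shift {w v : ℕ → ℝ} (hw : ∀ n, 0 ≤ w n) (hws : Summable w)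
    (hv : ∀ n, 0 ≤ v n) (hv1 : ∀ n, v n ≤ 1) {l : Filter ℕ} (hl : l ≤ atTop) {U : ℕ → ℝ}
    (hU : ∀ k, Tendsto (fun n => v (n - k)) l (𝓝 (U k))) (j : ℕ) :
    Tendsto (fun n => ∑ k ∈ Finset.range (n - j + 1), w k * v (n - j - k)) l
      (𝓝 (∑' k, w k * U (j + k))) := by
  have h := tendsto_tsum_of_dominated_convergence (𝓕 := l)
    (f := fun n k => if k < n - j + 1 then w k * v (n - j - k) else 0)
    (g := fun k => w k * U (j + k)) (bound := w) hws ?_ ?_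
  · refine h.congr fun n => ?_
    rw [tsum_eq_sum (s := Finset.range (n - j + 1))]
    · exact Finset.sum_congr rfl fun k hk => if_pos (Finset.mem_range.1 hk)
    · exact fun k hk => if_neg (by simpa using hk)
  · intro k
    refine ((hU (j + k)).const_mul (w k)).congr' ?_
    filter_upwards [hl (eventually_ge_atTop (j + k))] with n hn
    rw [if_pos (by omega), Nat.sub_sub]
  · refine Eventually.of_forall fun n k => ?_
    split_ifs
    · rw [Real.norm_of_nonneg (mul_nonneg (hw _) (hv _))]
      exact mul_le_of_le_one_right (hw k) (hv1 _)
    · rw [norm_zero]; exact hw k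

/-- The renewal theorem, for a possibly periodic renewal sequence whose increments have
an exponential moment. -/
lemma exists_tendsto_renewal (hf : NonnegCoeff f) (h0 : coeff 0 f = 0)
    (h1 : HasSum (fun n => coeff n f) 1) {t : ℝ} (ht1 : 1 < t)
    (ht : Summable fun n => coeff n f * t ^ n) (hu : u = 1 + f * u) :
    ∃ g c, 0 < g ∧ 0 < c ∧
      Tendsto (fun n => coeff n u - c * coeff n (periodicOnes g)) atTop (𝓝 0) := by
  have hun := nonnegCoeff_of_eq_one_add_mul hf h0 hu
  have hr := nonnegCoeff_tailSeries hf h1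
  have hrs := summable_tailSeries hf h1 ht1 ht
  have hr0 : coeff 0 (tailSeries f) = 1 := by
    rw [tailSeries, coeff_mk, zero_add, Finset.sum_range_one, h0, sub_zero]
  have hru : ∀ n, ∑ k ∈ Finset.range (n + 1), coeff k (tailSeries f) * coeff (n - k) u = 1 := by
    intro n
    rw [← coeff_mul_eq_sum_range, tailSeries_mul hu]
    simp
  have hu1 : ∀ n, coeff n u ≤ 1 := by
    intro n
    have := Finset.single_le_sum
      (f := fun k => coeff k (tailSeries f) * coeff (n - k) u)
      (fun k _ => mul_nonneg (hr k) (hun _)) (Finset.mem_range.2 (Nat.succ_pos n))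
    rw [hru n] at this
    simpa [hr0] using this
  set s : Set ℕ := {n | 0 < coeff n f} with hs
  set g := Nat.setGcd s with hgdef
  have hgs : ∀ k, coeff k f ≠ 0 → g ∣ k := fun k hk =>
    Nat.setGcd_dvd_of_mem (show k ∈ s from lt_of_le_of_ne (hf k) (Ne.symm hk))
  have hg : 0 < g := by
    rw [Nat.pos_iff_ne_zero]
    intro hg0
    rw [hgdef, Nat.setGcd_eq_zero_iff] at hg0
    have : (fun n => coeff n f) = fun _ => 0 := by
      funext n
      by_contra hn
      have hn' : n ∈ s := lt_of_le_of_ne (hf n) (Ne.symm hn)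
      have := hg0 hn'
      rw [Set.mem_singleton_iff] at this
      rw [this] at hn
      exact hn h0
    rw [this] at h1
    exact zero_ne_one (hasSum_zero.unique h1)
  have hudvd : ∀ n, ¬ g ∣ n → coeff n u = 0 := fun n hn => coeff_eq_zero_of_not_dvd hgs h0 hu hn
  set B : Filter ℕ := atTop ⊓ 𝓟 {n | g ∣ n} with hB
  have hBne : B.NeBot := by
    rw [hB, ← frequently_mem_iff_neBot, frequently_atTop]
    exact fun a => ⟨g * a, Nat.le_mul_of_pos_left a hg, dvd_mul_right g a⟩
  set Λ : Set ℝ := {l | MapClusterPt l B fun n => coeff n u} with hΛ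
  have hmem : ∀ n, coeff n u ∈ Set.Icc (0 : ℝ) 1 := fun n => ⟨hun n, hu1 n⟩
  have hΛsub : Λ ⊆ Set.Icc 0 1 := fun l hl =>
    isClosed_Icc.mem_of_mapClusterPt hl (Eventually.of_forall hmem)
  have hΛc : IsCompact Λ :=
    isCompact_Icc.of_isClosed_subset isClosed_setOfPred_clusterPt hΛsub
  have hΛne : Λ.Nonempty := by
    obtain ⟨l, -, hl⟩ := (isCompact_Icc (a := (0 : ℝ)) (b := 1)) (f := B.map fun n => coeff n u)
      (tendsto_principal.2 (Eventually.of_forall hmem))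
    exact ⟨l, hl⟩
  set S : ℝ := ∑' k, coeff k (tailSeries f) * (if g ∣ k then 1 else 0) with hS
  have key : ∀ L ∈ Λ, ∀ ε : ℝ, ε ≠ 0 → (∀ l ∈ Λ, ε * l ≤ ε * L) → L * S = 1 := by
    intro L hL ε hε hext
    obtain ⟨𝓕, h𝓕B, h𝓕L⟩ := mapClusterPt_iff_ultrafilter.1 hL
    have h𝓕top : (𝓕 : Filter ℕ) ≤ atTop := h𝓕B.trans inf_le_left
    have h𝓕g : ∀ᶠ n in (𝓕 : Filter ℕ), g ∣ n :=
      h𝓕B.trans inf_le_right (mem_principal_self _)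
    have hex : ∀ k : ℕ, ∃ l, Tendsto (fun n : ℕ => coeff (n - k) u) (𝓕 : Filter ℕ) (𝓝 l) := by
      intro k
      obtain ⟨l, -, hl⟩ := isCompact_Icc.ultrafilter_le_nhds'
        (𝓕.map fun n : ℕ => coeff (n - k) u)
        (Ultrafilter.mem_map.2 (univ_mem' fun n => hmem (n - k)))
      exact ⟨l, hl⟩
    choose U hU using hex
    have hU0 : U 0 = L := tendsto_nhds_unique (hU 0) h𝓕L
    have hUΛ : ∀ k, g ∣ k → U k ∈ Λ := by
      intro k hk
      refine MapClusterPt.of_comp (φ := fun n => n - k) (p := (𝓕 : Filter ℕ)) ?_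
        (hU k).mapClusterPt
      refine tendsto_inf.2 ⟨(tendsto_sub_atTop_nat k).mono_left h𝓕top, ?_⟩
      rw [tendsto_principal]
      filter_upwards [h𝓕g] with n hn
      exact Nat.dvd_sub hn hk
    have hUz : ∀ k, ¬ g ∣ k → U k = 0 := by
      intro k hk
      refine tendsto_nhds_unique (hU k) (tendsto_const_nhds.congr' ?_)
      filter_upwards [h𝓕g, h𝓕top (eventually_ge_atTop k)] with n hn hkn
      refine (hudvd _ fun h => hk ?_).symm
      exact (Nat.dvd_sub_iff_right hkn hn).1 h
    have hrec : ∀ j, U j = ∑' k, coeff k f * U (j + k) := by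
      intro j
      refine tendsto_nhds_unique (hU j)
        ((tendsto_conv_of_tendsto_shift hf h1.summable hun hu1 h𝓕top hU j).congr' ?_)
      filter_upwards [h𝓕top (eventually_gt_atTop j)] with n hn
      conv_rhs => rw [hu, map_add, coeff_one, if_neg (by omega), zero_add, coeff_mul_eq_sum_range]
    have hstep : ∀ j k, g ∣ j → U j = L → 0 < coeff k f → U (j + k) = L := by
      intro j k hj hjL hk
      have hsum : Summable fun k => coeff k f * U (j + k) := by
        refine Summable.of_norm_bounded h1.summable fun k => ?_
        have hb : U (j + k) ∈ Set.Icc (0 : ℝ) 1 :=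
          isClosed_Icc.mem_of_tendsto (hU (j + k)) (Eventually.of_forall fun n => hmem _)
        rw [Real.norm_of_nonneg (mul_nonneg (hf k) hb.1)]
        exact mul_le_of_le_one_right (hf k) hb.2
      have hz : HasSum (fun k => ε * (coeff k f * L - coeff k f * U (j + k))) 0 := by
        have := ((h1.mul_right L).sub hsum.hasSum).mul_left ε
        rwa [← hrec j, hjL, one_mul, sub_self, mul_zero] at this
      have hnn : ∀ k, 0 ≤ ε * (coeff k f * L - coeff k f * U (j + k)) := by
        intro k
        by_cases hk0 : coeff k f = 0
        · simp [hk0]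
        · have := hext _ (hUΛ (j + k) (dvd_add hj (hgs k hk0)))
          have h2 := mul_nonneg (hf k) (sub_nonneg.2 this)
          linarith
      have := congrFun ((hasSum_zero_iff_of_nonneg hnn).1 hz) k
      simp only [Pi.zero_apply, mul_eq_zero, hε, false_or] at this
      have h3 : coeff k f * (L - U (j + k)) = 0 := by linarith
      rcases mul_eq_zero.1 h3 with h | h
      · exact absurd h hk.ne'
      · linarith
    have hclos : ∀ k ∈ AddSubmonoid.closure s, g ∣ k ∧ ∀ j, g ∣ j → U j = L → U (j + k) = L := by
      intro k hk
      induction hk using AddSubmonoid.closure_induction with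
      | mem k hk => exact ⟨hgs k (ne_of_gt hk), fun j hj hjL => hstep j k hj hjL hk⟩
      | zero => exact ⟨dvd_zero g, fun j _ h => h⟩
      | add a b _ _ ha hb =>
        refine ⟨dvd_add ha.1 hb.1, fun j hj hjL => ?_⟩
        rw [← add_assoc]
        exact hb.2 _ (dvd_add hj ha.1) (ha.2 j hj hjL)
    obtain ⟨N, hN⟩ := Nat.exists_mem_closure_of_ge s
    have hJ : ∀ k, U (g * N + k) = L * if g ∣ k then 1 else 0 := by
      intro k
      split_ifs with hk
      · rw [mul_one]
        have hmem := hN (g * N + k)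
          ((Nat.le_mul_of_pos_left N hg).trans (Nat.le_add_right _ _))
          (dvd_add (dvd_mul_right g N) hk)
        have := (hclos _ hmem).2 0 (dvd_zero g) hU0
        rwa [zero_add] at this
      · rw [mul_zero]
        exact hUz _ fun h => hk ((Nat.dvd_add_right (dvd_mul_right g N)).1 h)
    have hlim := tendsto_conv_of_tendsto_shift hr hrs hun hu1 h𝓕top hU (g * N)
    simp only [hru] at hlim
    have := tendsto_nhds_unique tendsto_const_nhds hlim
    rw [this, hS, ← tsum_mul_left]
    refine tsum_congr fun k => ?_
    rw [hJ]
    ring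
  have hSsum : Summable fun k => coeff k (tailSeries f) * (if g ∣ k then (1 : ℝ) else 0) := by
    refine Summable.of_nonneg_of_le (fun k => mul_nonneg (hr k) (by split_ifs <;> norm_num))
      (fun k => ?_) hrs
    exact mul_le_of_le_one_right (hr k) (by split_ifs <;> norm_num)
  have hSpos : 0 < S := by
    refine lt_of_lt_of_le one_pos ?_
    have := hSsum.le_tsum 0 fun k _ => mul_nonneg (hr k) (by split_ifs <;> norm_num)
    rw [hr0, if_pos (dvd_zero g), mul_one] at this
    exact this
  have hall : ∀ l ∈ Λ, l = S⁻¹ := by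
    intro l hl
    obtain ⟨a, ha, ha'⟩ := hΛc.exists_isLeast hΛne
    obtain ⟨b, hb, hb'⟩ := hΛc.exists_isGreatest hΛne
    have h2 := key a ha (-1) (by norm_num) fun l hl => by linarith [ha' hl]
    have h3 := key b hb 1 one_ne_zero fun l hl => by linarith [hb' hl]
    have h4 : a = S⁻¹ := eq_inv_of_mul_eq_one_left h2
    have h5 : b = S⁻¹ := eq_inv_of_mul_eq_one_left h3
    exact le_antisymm (h5 ▸ hb' hl) (h4 ▸ ha' hl)
  have htend : Tendsto (fun n => coeff n u) B (𝓝 S⁻¹) :=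
    isCompact_Icc.tendsto_nhds_of_unique_mapClusterPt (Eventually.of_forall hmem)
      fun l _ hl => hall l hl
  refine ⟨g, S⁻¹, hg, inv_pos.2 hSpos, ?_⟩
  rw [Metric.tendsto_nhds]
  intro ε hε
  have := (Metric.tendsto_nhds.1 htend) ε hε
  rw [hB, eventually_inf_principal] at this
  filter_upwards [this] with n hn
  by_cases hgn : g ∣ n
  · have := hn hgn
    rw [Real.dist_eq] at this
    simpa [periodicOnes, hgn] using this
  · simpa [periodicOnes, hgn, hudvd n hgn] using hε

end Renewal

section System

open PowerSeries

variable {F : PowerSeries ℝ}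

lemma RegularGrowth.exists_partial_sum_gt (hF : RegularGrowth F) (h0 : coeff 0 F = 0)
    (hne : F ≠ 0) : ∃ t : ℝ, 0 < t ∧ SummableCoeff (rescale t F) ∧
      ∃ N, 1 < ∑ n ∈ Finset.range N, t ^ n * coeff n F := by
  rcases hF.2 with ⟨P, rfl⟩ | ⟨r, hr, hG⟩
  · obtain ⟨k, hk⟩ := hF.1.exists_pos hne
    have hk0 : k ≠ 0 := by rintro rfl; exact hk.ne' h0
    set a := coeff k (P : PowerSeries ℝ) with ha
    refine ⟨a⁻¹ + 1, by positivity, summableCoeff_rescale_coe _ P, k + 1, ?_⟩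
    have ht : 1 ≤ a⁻¹ + 1 := by linarith [inv_pos.2 hk]
    calc (1 : ℝ) = a⁻¹ * a := (inv_mul_cancel₀ hk.ne').symm
      _ < (a⁻¹ + 1) * a := by linarith
      _ ≤ (a⁻¹ + 1) ^ k * a :=
        mul_le_mul_of_nonneg_right (le_self_pow₀ ht hk0) hk.le
      _ ≤ _ := Finset.single_le_sum
        (f := fun n => (a⁻¹ + 1) ^ n * coeff n (P : PowerSeries ℝ))
        (fun i _ => mul_nonneg (by positivity) (hF.1 i)) (Finset.self_mem_range_succ k)
  · have hns : ¬ Summable fun n => r ^ n * coeff n F := by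
      intro h
      refine hG.not_summable (h.abs.congr fun n => ?_)
      rw [coeff_rescale]
    rw [not_summable_iff_tendsto_nat_atTop_of_nonneg
      (fun n => mul_nonneg (by positivity) (hF.1 n))] at hns
    obtain ⟨N, hN⟩ := (hns.eventually_gt_atTop 1).exists
    have hcont : Continuous fun s : ℝ => ∑ n ∈ Finset.range N, s ^ n * coeff n F := by fun_prop
    have h1 : ∀ᶠ s in 𝓝[<] r, 1 < ∑ n ∈ Finset.range N, s ^ n * coeff n F :=
      (hcont.continuousAt.eventually_const_lt hN).filter_mono nhdsWithin_le_nhds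
    have h2 : ∀ᶠ s in 𝓝[<] r, 0 < s := (lt_mem_nhds hr).filter_mono nhdsWithin_le_nhds
    obtain ⟨s, ⟨hs1, hs2⟩, hs3⟩ := ((h1.and h2).and self_mem_nhdsWithin).exists
    exact ⟨s, hs2, hG.summable_of_lt hs2 hs3, N, hs1⟩

lemma RegularGrowth.exists_hasSum_one (hF : RegularGrowth F) (h0 : coeff 0 F = 0)
    (hne : F ≠ 0) : ∃ ρ t : ℝ, 0 < ρ ∧ ρ < t ∧ SummableCoeff (rescale t F) ∧
      HasSum (fun n => coeff n (rescale ρ F)) 1 := by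
  obtain ⟨t, ht, hs, N, hN⟩ := hF.exists_partial_sum_gt h0 hne
  simp only [SummableCoeff, coeff_rescale] at hs
  have hle : ∀ n, ∀ s ∈ Set.Icc 0 t, ‖s ^ n * coeff n F‖ ≤ |t ^ n * coeff n F| := by
    intro n s hs
    rw [Real.norm_eq_abs, abs_mul, abs_mul, abs_pow, abs_pow, abs_of_nonneg hs.1,
      abs_of_nonneg ht.le]
    exact mul_le_mul_of_nonneg_right (pow_le_pow_left₀ hs.1 hs.2 n) (abs_nonneg _)
  have hcont : ContinuousOn (fun s : ℝ => ∑' n, s ^ n * coeff n F) (Set.Icc 0 t) :=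
    continuousOn_tsum (fun n => by fun_prop) hs hle
  have hzero : ∑' n, (0 : ℝ) ^ n * coeff n F = 0 := by
    refine (tsum_congr fun n => ?_).trans tsum_zero
    rcases Nat.eq_zero_or_pos n with rfl | hn
    · rw [h0, mul_zero]
    · rw [zero_pow hn.ne', zero_mul]
  have hgt : 1 < ∑' n, t ^ n * coeff n F :=
    hN.trans_le (hs.of_abs.sum_le_tsum _ fun n _ => mul_nonneg (by positivity) (hF.1 n))
  obtain ⟨ρ, hρ, hρ1⟩ := intermediate_value_Icc ht.le hcont
    (show (1 : ℝ) ∈ _ from ⟨by simp only [hzero]; exact zero_le_one, hgt.le⟩)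
  simp only at hρ1
  have hρ0 : 0 < ρ := by
    refine lt_of_le_of_ne hρ.1 ?_
    rintro rfl
    rw [hzero] at hρ1
    exact zero_ne_one hρ1
  have hρt : ρ < t := by
    refine lt_of_le_of_ne hρ.2 ?_
    rintro rfl
    exact hgt.ne' hρ1
  have hsum : Summable fun n => ρ ^ n * coeff n F :=
    Summable.of_norm_bounded hs fun n => hle n ρ hρ
  refine ⟨ρ, t, hρ0, hρt, ?_, ?_⟩
  · simpa only [SummableCoeff, coeff_rescale] using hs
  · simp only [coeff_rescale]
    rw [← hρ1]
    exact hsum.hasSum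

lemma RegularGrowth.exists_eq_one_add_mul (hF : RegularGrowth F) (h0 : coeff 0 F = 0) :
    ∃ U, RegularGrowth U ∧ U = 1 + F * U := by
  rcases eq_or_ne F 0 with rfl | hne
  · exact ⟨1, regularGrowth_one, by rw [zero_mul, add_zero]⟩
  have hU : (1 - F)⁻¹ = 1 + F * (1 - F)⁻¹ := by
    have h : (1 - F) * (1 - F)⁻¹ = 1 := PowerSeries.mul_inv_cancel _ (by
      rw [coeff_zero_eq_constantCoeff] at h0
      rw [map_sub, h0, map_one, sub_zero]
      exact one_ne_zero)
    linear_combination h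
  generalize (1 - F)⁻¹ = U at hU
  refine ⟨U, ⟨nonnegCoeff_of_eq_one_add_mul hF.1 h0 hU, Or.inr ?_⟩, hU⟩
  obtain ⟨ρ, t, hρ, hρt, hs, h1⟩ := hF.exists_hasSum_one h0 hne
  have hs' : Summable fun n => coeff n (rescale ρ F) * (t / ρ) ^ n := by
    refine hs.of_abs.congr fun n => ?_
    rw [coeff_rescale, coeff_rescale, mul_right_comm, ← mul_pow, mul_div_cancel₀ _ hρ.ne']
  have hU' : rescale ρ U = 1 + rescale ρ F * rescale ρ U := by
    rw [← map_mul, ← map_one (rescale ρ), ← map_add, ← hU]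
  obtain ⟨g, c, hg, hc, hlim⟩ := exists_tendsto_renewal (hF.1.rescale hρ.le)
    (by rw [coeff_rescale, h0, mul_zero]) h1 ((one_lt_div hρ).2 hρt) hs' hU'
  refine ⟨ρ, hρ, g, 0, PowerSeries.C c, hg, (regularGrowth_C hc.le).1, ?_, ?_, ?_⟩
  · intro h
    have := congrArg (coeff 0) h
    rw [coeff_zero_C, map_zero] at this
    exact hc.ne' this
  · rw [← Polynomial.coe_C]
    exact summableCoeff_coe _
  · refine hlim.congr fun n => ?_
    rw [zero_add, pow_one, map_sub, coeff_C_mul, pow_zero, div_one]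

/-- A series in a tuple of series satisfying a strictly triangular linear system with regular
coefficients is regular. -/
lemma regularGrowth_of_system_fin (n : ℕ) {v g : Fin n → PowerSeries ℝ}
    {A : Fin n → Fin n → PowerSeries ℝ} (hg : ∀ i, RegularGrowth (g i))
    (hA : ∀ i j, RegularGrowth (A i j)) (hA0 : ∀ i j, coeff 0 (A i j) = 0)
    (h : ∀ i, v i = g i + ∑ j, A i j * v j) : ∀ i, RegularGrowth (v i) := by
  induction n with
  | zero => exact fun i => i.elim0
  | succ n ih =>
    obtain ⟨U, hU, hUeq⟩ := (hA 0 0).exists_eq_one_add_mul (hA0 0 0)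
    have hv0 : v 0 = U * (g 0 + ∑ j : Fin n, A 0 j.succ * v j.succ) := by
      have := h 0
      rw [Fin.sum_univ_succ] at this
      linear_combination U * this - (v 0) * hUeq
    have htail : ∀ i : Fin n, RegularGrowth (v i.succ) := by
      refine ih (v := fun i => v i.succ) (g := fun i => g i.succ + A i.succ 0 * U * g 0)
        (A := fun i j => A i.succ 0 * U * A 0 j.succ + A i.succ j.succ)
        (fun i => (hg _).add (((hA _ _).mul hU).mul (hg _)))
        (fun i j => (((hA _ _).mul hU).mul (hA _ _)).add (hA _ _)) (fun i j => ?_) fun i => ?_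
      · simp only [coeff_zero_eq_constantCoeff] at hA0 ⊢
        rw [map_add, map_mul, hA0, hA0, mul_zero, add_zero]
      · have := h i.succ
        rw [Fin.sum_univ_succ] at this
        simp only [add_mul, Finset.sum_add_distrib]
        rw [this, hv0, mul_add U, Finset.mul_sum, mul_add, Finset.mul_sum]
        simp only [mul_assoc]
        ring
    intro i
    refine Fin.cases ?_ htail i
    rw [hv0]
    exact hU.mul ((hg 0).add (RegularGrowth.sum _ fun j _ => (hA _ _).mul (htail j)))

lemma regularGrowth_of_system {ι : Type*} [Fintype ι] {v g : ι → PowerSeries ℝ}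
    {A : ι → ι → PowerSeries ℝ} (hg : ∀ i, RegularGrowth (g i))
    (hA : ∀ i j, RegularGrowth (A i j)) (hA0 : ∀ i j, coeff 0 (A i j) = 0)
    (h : ∀ i, v i = g i + ∑ j, A i j * v j) (i : ι) : RegularGrowth (v i) := by
  let e := Fintype.equivFin ι
  have := regularGrowth_of_system_fin (Fintype.card ι) (v := fun i => v (e.symm i))
    (g := fun i => g (e.symm i)) (A := fun i j => A (e.symm i) (e.symm j)) (fun i => hg _)
    (fun i j => hA _ _) (fun i j => hA0 _ _)
    (fun i => by rw [h (e.symm i), ← e.symm.sum_comp]) (e i)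
  rwa [Equiv.symm_apply_apply] at this

lemma GrowthAt.exists_periodic {r : ℝ} (hF : GrowthAt r F) :
    ∃ d p c, 0 < p ∧ (∀ n, 0 ≤ c n) ∧ (∃ n, 0 < c n) ∧ PeriodicGrowth d p c (rescale r F) := by
  obtain ⟨p, d, C, hp, h⟩ := hF
  obtain ⟨c, h1, h2, h3⟩ := h.exists_periodicGrowth hp
  exact ⟨d, p, c, hp, h1, h2, h3⟩

lemma PeriodicGrowth.pos_of_monotone {r : ℝ} (hr : 0 < r) {d p : ℕ} (hp : 0 < p) {c : ℕ → ℝ}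
    (hF : PeriodicGrowth d p c (rescale r F))
    (hmono : Monotone fun n => coeff n F) (hc : ∃ n, 0 < c n) (n : ℕ) : 0 < c n := by
  obtain ⟨hper, hlim⟩ := hF
  have hper' : Function.Periodic c p := hper
  have hmul : ∀ n k, c (n + k * p) = c n := fun n k => hper'.nat_mul k n
  have hsub : ∀ i, Tendsto (fun k : ℕ => i + k * p) atTop atTop := fun i =>
    tendsto_atTop_mono (fun k => (Nat.le_mul_of_pos_right k hp).trans (Nat.le_add_left _ _))
      tendsto_id
  have hβ : ∀ i, Tendsto (fun k : ℕ => coeff (i + k * p) (rescale r F) /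
      (((i + k * p : ℕ) : ℝ) + 1) ^ d) atTop (𝓝 (c i)) := by
    intro i
    have := (hlim.comp (hsub i)).add_const (c i)
    rw [zero_add] at this
    refine this.congr fun k => ?_
    simp only [Function.comp_apply, hmul, sub_add_cancel]
  have hstep : ∀ i, r * c i ≤ c (i + 1) := by
    intro i
    have h1 := ((hβ i).const_mul r).mul ((tendsto_shift_pow d 1).comp (hsub i))
    rw [mul_one] at h1
    refine le_of_tendsto_of_tendsto' h1 (hβ (i + 1)) fun k => ?_
    have h2 : i + 1 + k * p = i + k * p + 1 := by ring
    rw [h2, Function.comp_apply]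
    generalize i + k * p = N
    rw [coeff_rescale, coeff_rescale, Nat.cast_one, Nat.cast_add, Nat.cast_one, div_pow,
      ← mul_div_assoc r, div_mul_div_cancel₀ (by positivity)]
    refine div_le_div_of_nonneg_right ?_ (by positivity)
    rw [← mul_assoc, ← pow_succ']
    exact mul_le_mul_of_nonneg_left (hmono (Nat.le_succ N)) (by positivity)
  obtain ⟨i, hi⟩ := hc
  have hge : ∀ k, 0 < c (i + k) := by
    intro k
    induction k with
    | zero => exact hi
    | succ k ih => exact (mul_pos hr ih).trans_le (hstep _)
  rw [← hmul n i]
  have : i ≤ n + i * p := (Nat.le_mul_of_pos_right i hp).trans (Nat.le_add_left _ _)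
  rw [← Nat.add_sub_cancel' this]
  exact hge _

lemma PeriodicGrowth.oppositeSeries_eq {r : ℝ} (hr : 0 < r) {d p : ℕ} (hp : 0 < p) {c : ℕ → ℝ}
    (hF : PeriodicGrowth d p c (rescale r F)) (hc : ∀ n, 0 < c n) {m : ℕ} {ω : ℕ → ℝ}
    (hω : OppositeSeries (fun n => coeff (n + m) F) ω) :
    ∃ s < p, ω = fun k => r ^ k * (c (s + (p - 1) * k) / c s) := by
  obtain ⟨hper, hlim⟩ := hF
  have hper' : Function.Periodic c p := hper
  obtain ⟨φ, hφ, hω⟩ := hω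
  obtain ⟨s, hsp, hs⟩ : ∃ s < p, ∃ᶠ j in atTop, (φ j + m) % p = s := by
    by_contra! hcon
    have h1 : ∀ᶠ j in (atTop : Filter ℕ), ∀ s ∈ Finset.range p, (φ j + m) % p ≠ s :=
      (eventually_all_finset _).2 fun s hs => hcon s (Finset.mem_range.1 hs)
    obtain ⟨j, hj⟩ := h1.exists
    exact hj _ (Finset.mem_range.2 (Nat.mod_lt _ hp)) rfl
  refine ⟨s, hsp, funext fun k => ?_⟩
  set L : Filter ℕ := atTop ⊓ 𝓟 {j | (φ j + m) % p = s} with hL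
  have hne : L.NeBot := frequently_mem_iff_neBot.1 hs
  have hmod : ∀ᶠ j in L, (φ j + m) % p = s := mem_inf_of_right (mem_principal_self _)
  have hφk : ∀ᶠ j in L, k ≤ φ j :=
    (hφ.tendsto_atTop.mono_left inf_le_left).eventually (eventually_ge_atTop k)
  have hN : Tendsto (fun j => φ j + m) L atTop :=
    (tendsto_add_atTop_nat m).comp (hφ.tendsto_atTop.mono_left inf_le_left)
  have hN' : Tendsto (fun j => φ j - k + m) L atTop :=
    (tendsto_add_atTop_nat m).comp
      ((tendsto_sub_atTop_nat k).comp (hφ.tendsto_atTop.mono_left inf_le_left))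
  have hden : Tendsto (fun j => coeff (φ j + m) (rescale r F) / (((φ j + m : ℕ) : ℝ) + 1) ^ d) L
      (𝓝 (c s)) := by
    have := (hlim.comp hN).add_const (c s)
    rw [zero_add] at this
    refine this.congr' ?_
    filter_upwards [hmod] with j hj
    rw [Function.comp_apply, ← hj, hper'.map_mod_nat, sub_add_cancel]
  have hnum : Tendsto
      (fun j => coeff (φ j - k + m) (rescale r F) / (((φ j - k + m : ℕ) : ℝ) + 1) ^ d) L
      (𝓝 (c (s + (p - 1) * k))) := by
    have := (hlim.comp hN').add_const (c (s + (p - 1) * k))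
    rw [zero_add] at this
    refine this.congr' ?_
    filter_upwards [hmod, hφk] with j hj hk
    have hck : c (s + (p - 1) * k) = c (φ j - k + m) := by
      rw [← hper'.map_mod_nat (s + (p - 1) * k), ← hj, Nat.mod_add_mod]
      have : φ j + m + (p - 1) * k = φ j - k + m + k * p := by
        obtain ⟨q, rfl⟩ := Nat.exists_eq_succ_of_ne_zero hp.ne'
        obtain ⟨e, he⟩ := Nat.exists_eq_add_of_le hk
        rw [he]
        simp only [Nat.succ_eq_add_one, Nat.add_sub_cancel, Nat.add_sub_cancel_left]
        ring
      rw [this, Nat.add_mul_mod_self_right, hper'.map_mod_nat]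
    rw [Function.comp_apply, hck, sub_add_cancel]
  have hratio := (((hnum.div hden (hc s).ne').mul ((tendsto_shift_pow d k).comp hN')).const_mul
    (r ^ k))
  rw [mul_one] at hratio
  refine tendsto_nhds_unique ((hω k).mono_left inf_le_left) (hratio.congr' ?_)
  filter_upwards [hφk] with j hk
  obtain ⟨e, he⟩ := Nat.exists_eq_add_of_le hk
  have he' : φ j - k + m = e + m := by omega
  simp only [Pi.div_apply, Function.comp_apply]
  rw [he', he, coeff_rescale, coeff_rescale]
  push_cast
  have h1 : (e : ℝ) + m + k + 1 = k + e + m + 1 := by ring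
  have h2 : (0 : ℝ) < (e : ℝ) + m + 1 := by positivity
  have h3 : (0 : ℝ) < (k : ℝ) + e + m + 1 := by positivity
  rw [h1, show k + e + m = k + (e + m) by ring, pow_add r k]
  rcases eq_or_ne (coeff (k + (e + m)) F) 0 with h0 | h0
  · rw [h0]; simp
  · rw [div_pow]
    field_simp

lemma RegularGrowth.finite_oppositeSeries (hF : RegularGrowth F)
    (hmono : Monotone fun n => coeff n F) (m : ℕ) (hpos : 0 < coeff m F) :
    {ω | OppositeSeries (fun n => coeff (n + m) F) ω}.Finite := by
  rcases hF.2 with ⟨P, rfl⟩ | ⟨r, hr, hG⟩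
  · have h1 := hmono (show m ≤ m + (P.natDegree + 1) by omega)
    simp only [Polynomial.coeff_coe] at h1 hpos
    rw [Polynomial.coeff_eq_zero_of_natDegree_lt (n := m + (P.natDegree + 1)) (by omega)] at h1
    exact absurd hpos h1.not_gt
  · obtain ⟨d, p, c, hp, -, hc, hper⟩ := hG.exists_periodic
    have hcpos := hper.pos_of_monotone hr hp hmono hc
    refine ((Finset.range p).finite_toSet.image
      fun s => fun k => r ^ k * (c (s + (p - 1) * k) / c s)).subset fun ω hω => ?_
    obtain ⟨s, hs, rfl⟩ := hper.oppositeSeries_eq hr hp hcpos hω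
    exact ⟨s, by simpa using hs, rfl⟩

end System

section Cones

variable {V W : Type*} {G : SimpleGraph V} {x y y' y'' : V} {δ : ℝ} {K : ℕ}

lemma dist_le_dist_hom {H : SimpleGraph W} (hH : H.Connected) (f : H →g G) (a b : W) :
    G.dist (f a) (f b) ≤ H.dist a b := by
  obtain ⟨p, hp⟩ := hH.exists_walk_length_eq_dist a b
  rw [← hp, ← Walk.length_map f p]
  exact dist_le _

lemma dist_iso (hG : G.Connected) (φ : G ≃g G) (a b : V) : G.dist (φ a) (φ b) = G.dist a b := by
  refine le_antisymm (dist_le_dist_hom hG φ.toHom a b) ?_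
  have := dist_le_dist_hom hG φ.symm.toHom (φ a) (φ b)
  simpa using this

lemma dist_adj (hG : G.Connected) {a b : V} (h : G.Adj a b) (z : V) :
    G.dist z b ≤ G.dist z a + 1 := by
  have := hG.dist_triangle (u := z) (v := a) (w := b)
  rwa [dist_eq_one_iff_adj.2 h] at this

lemma exists_adj_dist_eq (hG : G.Connected) {a b : V} {n : ℕ} (h : G.dist a b = n + 1) :
    ∃ c, G.Adj c b ∧ G.dist a c = n := by
  obtain ⟨p, hp⟩ := hG.exists_walk_length_eq_dist b a
  rw [dist_comm, h] at hp
  cases p with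
  | nil => simp at hp
  | cons hadj q =>
    rename_i c
    refine ⟨c, hadj.symm, ?_⟩
    rw [Walk.length_cons] at hp
    have h1 := dist_le q
    have h2 := dist_adj hG hadj.symm a
    rw [dist_comm] at h1
    omega

lemma IsGeodesic.dist_add (hG : G.Connected) {a b z : V} {p : G.Walk a b} (hp : IsGeodesic G p)
    (hz : z ∈ p.support) : G.dist a b = G.dist a z + G.dist z b := by
  classical
  refine le_antisymm hG.dist_triangle ?_
  rw [← hp, ← p.take_spec hz, Walk.length_append]
  exact Nat.add_le_add (dist_le _) (dist_le _)

/-- In a hyperbolic graph, geodesics from `x` to a point close to a point `w` far out in the cone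
of `y` pass close to `y`. -/
lemma exists_dist_add_of_mem_cone (hG : G.Connected) (hδ : IsDeltaHyperbolic G δ)
    {w v : V} (hw : w ∈ cone G x y) (h : G.dist w v + ⌈δ⌉₊ < G.dist y w) :
    ∃ u, G.dist y u ≤ ⌈δ⌉₊ ∧ G.dist x v = G.dist x u + G.dist u v := by
  obtain ⟨p₁, hp₁⟩ := hG.exists_walk_length_eq_dist x y
  obtain ⟨p₂, hp₂⟩ := hG.exists_walk_length_eq_dist y w
  obtain ⟨q, hq⟩ := hG.exists_walk_length_eq_dist w v
  obtain ⟨r, hr⟩ := hG.exists_walk_length_eq_dist x v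
  have hp : IsGeodesic G (p₁.append p₂) := by
    have hw' : G.dist x w = G.dist x y + G.dist y w := hw
    rw [IsGeodesic, Walk.length_append, hp₁, hp₂, hw']
  obtain ⟨z, hz, hyz⟩ := (hδ _ q r hp hq hr).1 y (by
    rw [Walk.mem_support_append_iff]
    exact Or.inl p₁.end_mem_support)
  have hyz' : G.dist y z ≤ ⌈δ⌉₊ := by exact_mod_cast hyz.trans (Nat.le_ceil δ)
  rcases hz with hz | hz
  · have h1 := IsGeodesic.dist_add hG hq hz
    have h2 := hG.dist_triangle (u := y) (v := z) (w := w)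
    rw [dist_comm (u := z) (v := w)] at h2
    omega
  · exact ⟨z, hyz', IsGeodesic.dist_add hG hr hz⟩

/-- The automorphism `φ` changes the distance to `x` at `v` by the same amount as if it were to
move `y` to `z`. -/
def LevelEq (G : SimpleGraph V) (x : V) (φ : G ≃g G) (y z v : V) : Prop :=
  G.dist x (φ v) + G.dist x y = G.dist x v + G.dist x z

/-- The automorphism `φ` is compatible with the distance to `x` in a neighborhood of the cone
of `y`. -/
def ConeLevelEq (G : SimpleGraph V) (x : V) (K : ℕ) (φ : G ≃g G) (y z : V) : Prop :=
  φ y = z ∧ ∀ w ∈ cone G x y, ∀ v, G.dist w v ≤ K → LevelEq G x φ y z v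

/-- The automorphism `φ` identifies the cones of `y` and `y'`. -/
def ConeIso (G : SimpleGraph V) (x : V) (K : ℕ) (φ : G ≃g G) (y y' : V) : Prop :=
  ConeLevelEq G x K φ y y' ∧ ConeLevelEq G x K φ.symm y' y

lemma self_mem_cone (y : V) : y ∈ cone G x y := by
  simp [cone]

variable {φ ψ : G ≃g G}

lemma ConeLevelEq.levelEq (h : ConeLevelEq G x K φ y y') {w : V} (hw : w ∈ cone G x y) :
    LevelEq G x φ y y' w := h.2 w hw w (by rw [dist_self]; exact Nat.zero_le K)

lemma ConeLevelEq.map_mem_cone (hG : G.Connected) (h : ConeLevelEq G x K φ y y') {w : V}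
    (hw : w ∈ cone G x y) : φ w ∈ cone G x y' := by
  have h1 : G.dist x (φ w) + G.dist x y = G.dist x w + G.dist x y' := h.levelEq hw
  have h2 := dist_iso hG φ y w
  rw [h.1] at h2
  have h3 : G.dist x w = G.dist x y + G.dist y w := hw
  show G.dist x (φ w) = G.dist x y' + G.dist y' (φ w)
  omega

lemma coneLevelEq_of_ball (hG : G.Connected) (hδ : IsDeltaHyperbolic G δ) (hK : 1 ≤ K)
    (hφ : φ y = y') (h : ∀ z, G.dist y z ≤ ⌈δ⌉₊ + 2 * K → LevelEq G x φ y y' z) :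
    ConeLevelEq G x K φ y y' := by
  have near : ∀ w ∈ cone G x y, φ w ∈ cone G x y' → ∀ v, G.dist w v ≤ K →
      LevelEq G x φ y y' v := by
    intro w hw hφw v hv
    by_cases hfar : G.dist y w ≤ K + ⌈δ⌉₊
    · refine h v ?_
      have := hG.dist_triangle (u := y) (v := w) (w := v)
      omega
    push Not at hfar
    obtain ⟨u, hu, hxu⟩ := exists_dist_add_of_mem_cone hG hδ hw (v := v) (by omega)
    have hyw := dist_iso hG φ y w
    rw [hφ] at hyw
    have hwv := dist_iso hG φ w v
    obtain ⟨u', hu', hxu'⟩ := exists_dist_add_of_mem_cone hG hδ hφw (v := φ v) (by omega)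
    obtain ⟨t, rfl⟩ := φ.surjective u'
    rw [← hφ, dist_iso hG] at hu'
    have e1 : G.dist x (φ u) + G.dist x y = G.dist x u + G.dist x y' := h u (by omega)
    have e2 : G.dist x (φ t) + G.dist x y = G.dist x t + G.dist x y' := h t (by omega)
    have t1 := hG.dist_triangle (u := x) (v := φ u) (w := φ v)
    have t2 := hG.dist_triangle (u := x) (v := t) (w := v)
    rw [dist_iso hG] at hxu' t1
    show G.dist x (φ v) + G.dist x y = G.dist x v + G.dist x y'
    omega
  have hcone : ∀ n, ∀ w ∈ cone G x y, G.dist y w = n → φ w ∈ cone G x y' := by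
    intro n
    induction n with
    | zero =>
      intro w _ h0
      rw [hG.dist_eq_zero_iff] at h0
      rw [← h0, hφ]
      exact self_mem_cone y'
    | succ n ih =>
      intro w hw hn
      obtain ⟨w', hadj, hw'n⟩ := exists_adj_dist_eq hG hn
      have hw0 : G.dist x w = G.dist x y + G.dist y w := hw
      have hw' : w' ∈ cone G x y := by
        have h1 := dist_adj hG hadj x
        have h2 := hG.dist_triangle (u := x) (v := y) (w := w')
        show G.dist x w' = G.dist x y + G.dist y w'
        omega
      have h1 : G.dist x (φ w) + G.dist x y = G.dist x w + G.dist x y' :=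
        near w' hw' (ih w' hw' hw'n) w (by rw [dist_eq_one_iff_adj.2 hadj]; exact hK)
      have h2 := dist_iso hG φ y w
      rw [hφ] at h2
      show G.dist x (φ w) = G.dist x y' + G.dist y' (φ w)
      omega
  exact ⟨hφ, fun w hw v hv => near w hw (hcone _ w hw rfl) v hv⟩

lemma coneIso_of_ball (hG : G.Connected) (hδ : IsDeltaHyperbolic G δ) (hK : 1 ≤ K)
    (hφ : φ y = y') (h : ∀ z, G.dist y z ≤ ⌈δ⌉₊ + 2 * K → LevelEq G x φ y y' z) :
    ConeIso G x K φ y y' := by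
  refine ⟨coneLevelEq_of_ball hG hδ hK hφ h,
    coneLevelEq_of_ball hG hδ hK (by rw [← hφ, RelIso.symm_apply_apply]) fun z hz => ?_⟩
  obtain ⟨z, rfl⟩ := φ.surjective z
  rw [← hφ, dist_iso hG] at hz
  have : G.dist x (φ z) + G.dist x y = G.dist x z + G.dist x y' := h z hz
  rw [LevelEq, RelIso.symm_apply_apply]
  exact this.symm

lemma ConeIso.symm (h : ConeIso G x K φ y y') : ConeIso G x K φ.symm y' y := ⟨h.2, h.1⟩

lemma coneIso_refl (y : V) : ConeIso G x K (RelIso.refl _) y y :=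
  ⟨⟨rfl, fun _ _ _ _ => rfl⟩, ⟨rfl, fun _ _ _ _ => rfl⟩⟩

lemma ConeLevelEq.trans (hG : G.Connected) (h : ConeLevelEq G x K φ y y')
    (h' : ConeLevelEq G x K ψ y' y'') : ConeLevelEq G x K (φ.trans ψ) y y'' := by
  refine ⟨by rw [RelIso.trans_apply, h.1, h'.1], fun w hw v hv => ?_⟩
  have e1 : G.dist x (φ v) + G.dist x y = G.dist x v + G.dist x y' := h.2 w hw v hv
  have e2 : G.dist x (ψ (φ v)) + G.dist x y' = G.dist x (φ v) + G.dist x y'' :=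
    h'.2 (φ w) (h.map_mem_cone hG hw) (φ v) (by rwa [dist_iso hG])
  show G.dist x (ψ (φ v)) + G.dist x y = G.dist x v + G.dist x y''
  omega

lemma ConeIso.trans (hG : G.Connected) (h : ConeIso G x K φ y y')
    (h' : ConeIso G x K ψ y' y'') : ConeIso G x K (φ.trans ψ) y y'' :=
  ⟨h.1.trans hG h'.1, h'.2.trans hG h.2⟩

lemma mem_cone_trans (hG : G.Connected) {z w : V} (hz : z ∈ cone G x y) (hw : w ∈ cone G x z) :
    w ∈ cone G x y := by
  have h1 : G.dist x z = G.dist x y + G.dist y z := hz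
  have h2 : G.dist x w = G.dist x z + G.dist z w := hw
  have h3 := hG.dist_triangle (u := x) (v := y) (w := w)
  have h4 := hG.dist_triangle (u := y) (v := z) (w := w)
  show G.dist x w = G.dist x y + G.dist y w
  omega

lemma ConeLevelEq.restrict (hG : G.Connected) (h : ConeLevelEq G x K φ y y') {z : V}
    (hz : z ∈ cone G x y) : ConeLevelEq G x K φ z (φ z) := by
  refine ⟨rfl, fun w hw v hv => ?_⟩
  have e1 : G.dist x (φ z) + G.dist x y = G.dist x z + G.dist x y' := h.levelEq hz
  have e2 : G.dist x (φ v) + G.dist x y = G.dist x v + G.dist x y' :=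
    h.2 w (mem_cone_trans hG hz hw) v hv
  show G.dist x (φ v) + G.dist x z = G.dist x v + G.dist x (φ z)
  omega

lemma ConeIso.restrict (hG : G.Connected) (h : ConeIso G x K φ y y') {z : V}
    (hz : z ∈ cone G x y) : ConeIso G x K φ z (φ z) := by
  refine ⟨h.1.restrict hG hz, ?_⟩
  have := h.2.restrict hG (h.1.map_mem_cone hG hz)
  rwa [RelIso.symm_apply_apply] at this

/-- Vertices have the same cone type if their cones are identified by an automorphism. -/
def coneSetoid (hG : G.Connected) (x : V) (K : ℕ) : Setoid V where
  r y y' := ∃ φ : G ≃g G, ConeIso G x K φ y y'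
  iseqv := ⟨fun y => ⟨_, coneIso_refl y⟩, fun ⟨_, h⟩ => ⟨_, h.symm⟩,
    fun ⟨_, h⟩ ⟨_, h'⟩ => ⟨_, h.trans hG h'⟩⟩

lemma finite_dist_le (hG : G.Connected) (hfin : UnifFiniteValence G) (x : V) (n : ℕ) :
    {z | G.dist x z ≤ n}.Finite := by
  obtain ⟨D, hD⟩ := hfin
  induction n with
  | zero =>
    refine (Set.finite_singleton x).subset fun z hz => ?_
    have : G.dist x z = 0 := Nat.le_zero.1 hz
    rw [hG.dist_eq_zero_iff] at this
    exact this.symm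
  | succ n ih =>
    refine (ih.union (ih.biUnion fun z _ => (hD z).1)).subset fun z hz => ?_
    rcases Nat.lt_or_ge n (G.dist x z) with h | h
    · obtain ⟨c, hc, hxc⟩ := exists_adj_dist_eq hG (n := n) (le_antisymm hz h)
      exact Or.inr (Set.mem_biUnion (show G.dist x c ≤ n from hxc.le) hc)
    · exact Or.inl h

lemma finite_coneType (hG : G.Connected) (hfin : UnifFiniteValence G)
    (hδ : IsDeltaHyperbolic G δ) (htrans : VertexTransitive G) (hK : 1 ≤ K) :
    Finite (Quotient (coneSetoid hG x K)) := by
  choose ψ hψ using fun y => htrans x y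
  set R := ⌈δ⌉₊ + 2 * K with hR
  have hfinR : Finite {z // G.dist x z ≤ R} := finite_dist_le hG hfin x R
  have hb : ∀ y z, G.dist x z ≤ R → G.dist x (ψ y z) ≤ G.dist x y + R ∧
      G.dist x y ≤ G.dist x (ψ y z) + R := by
    intro y z hz
    have h1 := dist_iso hG (ψ y) x z
    rw [hψ] at h1
    have h2 := hG.dist_triangle (u := x) (v := y) (w := ψ y z)
    have h3 := hG.dist_triangle (u := x) (v := ψ y z) (w := y)
    rw [dist_comm (u := ψ y z) (v := y)] at h3
    omega
  let col : V → {z // G.dist x z ≤ R} → Fin (2 * R + 1) := fun y z =>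
    ⟨G.dist x (ψ y z) + R - G.dist x y, by have := hb y z z.2; omega⟩
  have hcol : ∀ y y', col y = col y' → ∃ φ : G ≃g G, ConeIso G x K φ y y' := by
    intro y y' hab
    have hψs : (ψ y).symm y = x := by
      rw [RelIso.symm_apply_eq, hψ]
    refine ⟨(ψ y).symm.trans (ψ y'), coneIso_of_ball hG hδ hK ?_ fun z hz => ?_⟩
    · rw [RelIso.trans_apply, hψs, hψ]
    · obtain ⟨z, rfl⟩ := (ψ y).surjective z
      have hz' : G.dist x z ≤ R := by
        have := dist_iso hG (ψ y) x z
        rw [hψ] at this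
        omega
      have := congrArg Fin.val (congrFun hab ⟨z, hz'⟩)
      have h1 := hb y z hz'
      have h2 := hb y' z hz'
      simp only [col] at this
      rw [LevelEq, RelIso.trans_apply, RelIso.symm_apply_apply]
      omega
  refine Finite.of_injective (fun q : Quotient (coneSetoid hG x K) => col q.out) fun a b hab => ?_
  rw [← Quotient.out_equiv_out]
  exact hcol _ _ hab

end Cones

section Counting

open scoped Classical in
/-- The number of elements of `s` of a given class. -/
noncomputable def classCount {V : Type*} (S : Setoid V) (s : Finset V) (σ : Quotient S) : ℝ :=
  ({y ∈ s | Quotient.mk S y = σ}.card : ℝ)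

lemma sum_eq_sum_classCount {V : Type*} (S : Setoid V) [Fintype (Quotient S)] (s : Finset V)
    (m : Quotient S → ℝ) :
    ∑ y ∈ s, m (Quotient.mk S y) = ∑ τ, classCount S s τ * m τ := by
  classical
  rw [← Finset.sum_fiberwise s (Quotient.mk S)]
  refine Finset.sum_congr rfl fun τ _ => ?_
  rw [classCount, ← nsmul_eq_mul]
  convert Finset.sum_const (m τ) using 1
  exact Finset.sum_congr rfl fun y hy => by rw [(Finset.mem_filter.1 hy).2]

variable {V : Type*} {G : SimpleGraph V} (hG : G.Connected) (hfin : UnifFiniteValence G)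
  {x y y' : V} {K : ℕ} {φ : G ≃g G}

/-- The sphere of radius `n` about `x`. -/
noncomputable def sphereFinset (x : V) (n : ℕ) : Finset V :=
  ((finite_dist_le hG hfin x n).subset (fun _ hz => le_of_eq hz) :
    {z | G.dist x z = n}.Finite).toFinset

lemma mem_sphereFinset {n : ℕ} {z : V} : z ∈ sphereFinset hG hfin x n ↔ G.dist x z = n := by
  simp [sphereFinset]

/-- The number of neighbors of `z` that are closer to `x`. -/
noncomputable def numParents (G : SimpleGraph V) (x z : V) : ℕ :=
  {y | G.Adj y z ∧ G.dist x y + 1 = G.dist x z}.ncard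

lemma numParents_eq (hK : 1 ≤ K) (h : ConeIso G x K φ y y') :
    numParents G x y = numParents G x y' := by
  rw [numParents, ← Set.ncard_image_of_injective _ φ.injective, numParents]
  congr 1
  ext u
  obtain ⟨t, rfl⟩ := φ.surjective u
  rw [φ.injective.mem_set_image, Set.mem_ofPred_eq, Set.mem_ofPred_eq, ← h.1.1, φ.map_adj_iff]
  refine and_congr_right fun hadj => ?_
  have h1 : G.dist x (φ t) + G.dist x y = G.dist x t + G.dist x y' :=
    h.1.2 y (self_mem_cone y) t (by rw [dist_eq_one_iff_adj.2 hadj.symm]; exact hK)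
  rw [h.1.1]
  omega

lemma numParents_eq_card {n : ℕ} {z : V} (hz : G.dist x z = n + 1) [DecidableRel G.Adj] :
    numParents G x z = {y ∈ sphereFinset hG hfin x n | G.Adj y z}.card := by
  rw [numParents, ← Set.ncard_coe_finset]
  congr 1
  ext y
  simp only [Set.mem_ofPred_eq, Finset.coe_filter, mem_sphereFinset, hz, Nat.add_right_cancel_iff]
  exact and_comm

include hG hfin in
lemma numParents_pos {n : ℕ} {z : V} (hz : G.dist x z = n + 1) : 0 < numParents G x z := by
  classical
  obtain ⟨c, hc, hxc⟩ := exists_adj_dist_eq hG hz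
  rw [numParents_eq_card hG hfin hz, Finset.card_pos]
  exact ⟨c, by rw [Finset.mem_filter, mem_sphereFinset]; exact ⟨hxc, hc⟩⟩

open scoped Classical in
/-- The number of neighbors of `y` of cone type `σ` that are farther from `x`, each weighted by
the inverse of the number of its parents. -/
noncomputable def childWeight (x : V) (K : ℕ) (y : V) (σ : Quotient (coneSetoid hG x K)) : ℝ :=
  ∑' z, if G.Adj y z ∧ G.dist x z = G.dist x y + 1 ∧ Quotient.mk (coneSetoid hG x K) z = σ
    then (numParents G x z : ℝ)⁻¹ else 0

lemma childWeight_nonneg (σ : Quotient (coneSetoid hG x K)) : 0 ≤ childWeight hG x K y σ :=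
  tsum_nonneg fun z => by split_ifs <;> positivity

lemma childWeight_eq (hK : 1 ≤ K) (h : ConeIso G x K φ y y')
    (σ : Quotient (coneSetoid hG x K)) : childWeight hG x K y σ = childWeight hG x K y' σ := by
  classical
  rw [childWeight, childWeight]
  refine Eq.trans (tsum_congr fun z => ?_) (φ.toEquiv.tsum_eq _)
  rw [RelIso.coe_fn_toEquiv, ← h.1.1, φ.map_adj_iff]
  by_cases hadj : G.Adj y z
  · have h1 : G.dist x (φ z) + G.dist x y = G.dist x z + G.dist x y' :=
      h.1.2 y (self_mem_cone y) z (by rw [dist_eq_one_iff_adj.2 hadj]; exact hK)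
    by_cases hz : G.dist x z = G.dist x y + 1
    · have hc : z ∈ cone G x y := by
        show G.dist x z = G.dist x y + G.dist y z
        rw [hz, dist_eq_one_iff_adj.2 hadj]
      have hz' := h.restrict hG hc
      have hq : Quotient.mk (coneSetoid hG x K) (φ z) = Quotient.mk (coneSetoid hG x K) z :=
        (Quotient.sound (s := coneSetoid hG x K) ⟨φ, hz'⟩).symm
      have hz2 : G.dist x (φ z) = G.dist x (φ y) + 1 := by rw [h.1.1]; omega
      rw [hq, numParents_eq hK hz']
      simp only [hz, hz2]
    · have hz2 : ¬ G.dist x (φ z) = G.dist x (φ y) + 1 := by rw [h.1.1]; omega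
      simp only [hz, hz2, false_and, and_false, if_false]
  · simp only [hadj, false_and, if_false]

lemma childWeight_out (hK : 1 ≤ K) (σ : Quotient (coneSetoid hG x K)) (y : V) :
    childWeight hG x K y σ =
      childWeight hG x K (Quotient.mk (coneSetoid hG x K) y).out σ := by
  obtain ⟨φ, hφ⟩ := Quotient.exact (Quotient.out_eq (Quotient.mk (coneSetoid hG x K) y))
  exact (childWeight_eq hG hK hφ σ).symm

lemma classCount_sphere_succ (n : ℕ) (σ : Quotient (coneSetoid hG x K)) :
    classCount (coneSetoid hG x K) (sphereFinset hG hfin x (n + 1)) σ =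
      ∑ y ∈ sphereFinset hG hfin x n, childWeight hG x K y σ := by
  classical
  have h1 : ∀ y ∈ sphereFinset hG hfin x n, childWeight hG x K y σ =
      ∑ z ∈ sphereFinset hG hfin x (n + 1), if G.Adj y z then
        (if Quotient.mk (coneSetoid hG x K) z = σ then (numParents G x z : ℝ)⁻¹ else 0)
        else 0 := by
    intro y hy
    rw [mem_sphereFinset] at hy
    rw [childWeight, tsum_eq_sum (s := sphereFinset hG hfin x (n + 1))]
    · refine Finset.sum_congr rfl fun z hz => ?_
      rw [mem_sphereFinset] at hz
      simp only [hz, hy, true_and, ite_and]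
    · intro z hz
      rw [mem_sphereFinset] at hz
      refine if_neg fun h => hz ?_
      rw [h.2.1, hy]
  rw [Finset.sum_congr rfl h1, Finset.sum_comm, classCount, Finset.card_filter, Nat.cast_sum]
  refine Finset.sum_congr rfl fun z hz => ?_
  rw [mem_sphereFinset] at hz
  rw [← Finset.sum_filter, Finset.sum_const, ← numParents_eq_card hG hfin hz, nsmul_eq_mul]
  split_ifs
  · have := numParents_pos hG hfin hz
    rw [mul_inv_cancel₀ (by positivity), Nat.cast_one]
  · simp

/-- The generating function of the number of vertices of a given cone type on spheres. -/
noncomputable def sphereSeries (x : V) (K : ℕ) (σ : Quotient (coneSetoid hG x K)) :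
    PowerSeries ℝ :=
  PowerSeries.mk fun n => classCount (coneSetoid hG x K) (sphereFinset hG hfin x n) σ

lemma regularGrowth_sphereSeries [Finite (Quotient (coneSetoid hG x K))] (hK : 1 ≤ K)
    (σ : Quotient (coneSetoid hG x K)) : RegularGrowth (sphereSeries hG hfin x K σ) := by
  have := Fintype.ofFinite (Quotient (coneSetoid hG x K))
  refine regularGrowth_of_system
    (g := fun σ => PowerSeries.C (classCount (coneSetoid hG x K) (sphereFinset hG hfin x 0) σ))
    (A := fun σ τ => PowerSeries.C (childWeight hG x K τ.out σ) * PowerSeries.X)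
    (fun σ => regularGrowth_C (Nat.cast_nonneg _))
    (fun σ τ => (regularGrowth_C (childWeight_nonneg hG σ)).mul regularGrowth_X)
    (fun σ τ => PowerSeries.coeff_zero_mul_X _) (fun σ => ?_) σ
  ext n
  rw [map_add, map_sum]
  simp only [mul_assoc, PowerSeries.coeff_C_mul]
  cases n with
  | zero => simp [sphereSeries]
  | succ n =>
    simp only [PowerSeries.coeff_succ_X_mul, sphereSeries, PowerSeries.coeff_mk,
      PowerSeries.coeff_C, Nat.succ_ne_zero, if_false, zero_add]
    rw [classCount_sphere_succ hG hfin,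
      Finset.sum_congr rfl fun y _ => childWeight_out hG hK σ y,
      sum_eq_sum_classCount _ _ fun τ => childWeight hG x K τ.out σ]
    exact Finset.sum_congr rfl fun τ _ => mul_comm _ _

end Counting

section Embeddings

lemma regularGrowth_of_eventually_const {a : ℕ → ℝ} (ha : ∀ n, 0 ≤ a n) {k : ℕ}
    (hk : ∀ n, k ≤ n → a n = a k) : RegularGrowth (PowerSeries.mk a) := by
  induction k generalizing a with
  | zero =>
    obtain ⟨U, hU, hUeq⟩ := regularGrowth_X.exists_eq_one_add_mul (by simp)
    have h1 : ∀ n, PowerSeries.coeff n U = 1 := by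
      intro n
      induction n with
      | zero => rw [hUeq]; simp
      | succ n ih =>
        rw [hUeq, map_add, PowerSeries.coeff_succ_X_mul, ih]
        simp [PowerSeries.coeff_one]
    convert (regularGrowth_C (ha 0)).mul hU using 1
    ext n
    rw [PowerSeries.coeff_C_mul, h1, mul_one, PowerSeries.coeff_mk, hk n (Nat.zero_le n)]
  | succ k ih =>
    convert (regularGrowth_C (ha 0)).add (regularGrowth_X.mul
      (ih (a := fun n => a (n + 1)) (fun n => ha _) fun n hn => hk _ (by omega))) using 1
    ext n
    cases n with
    | zero => simp
    | succ n => simp [PowerSeries.coeff_succ_X_mul]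

variable {V W : Type*} {G : SimpleGraph V} (hG : G.Connected) (hfin : UnifFiniteValence G)
  {x y y' : V} {K : ℕ} {φ : G ≃g G} {H : SimpleGraph W} {w₀ : W}

include hG hfin in
lemma finite_embeddings [Finite W] (x : V) (n : ℕ) :
    {f : H ↪g G | ∀ w, G.dist x (f w) ≤ n}.Finite := by
  have h1 := Set.Finite.pi' (ι := W) fun _ => finite_dist_le hG hfin x n
  exact h1.preimage (f := fun f : H ↪g G => (f : W → V)) DFunLike.coe_injective.injOn

/-- The number of embeddings of `H` which map `w₀` to `z` and whose image lies in the ball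
of radius `d(x, z) + j` about `x`. -/
noncomputable def rootedCount (G : SimpleGraph V) (H : SimpleGraph W) (x : V) (w₀ : W) (j : ℕ)
    (z : V) : ℕ :=
  {f : H ↪g G | f w₀ = z ∧ ∀ w, G.dist x (f w) ≤ G.dist x z + j}.ncard

include hG hfin in
lemma rootedCount_le_of_coneLevelEq [Finite W] (hH : H.Connected)
    (hK : ∀ w, H.dist w₀ w ≤ K) (h : ConeLevelEq G x K φ y y') (j : ℕ) :
    rootedCount G H x w₀ j y ≤ rootedCount G H x w₀ j y' := by
  refine Set.ncard_le_ncard_of_injOn (fun f => f.trans φ.toRelEmbedding) ?_ ?_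
    ((finite_embeddings hG hfin x (G.dist x y' + j)).subset fun f hf => hf.2)
  · rintro f ⟨hf0, hf⟩
    refine ⟨by rw [← h.1, ← hf0]; rfl, fun w => ?_⟩
    have h1 : G.dist y (f w) ≤ K := by
      rw [← hf0]
      exact (dist_le_dist_hom hH f.toHom w₀ w).trans (hK w)
    have h2 : G.dist x (φ (f w)) + G.dist x y = G.dist x (f w) + G.dist x y' :=
      h.2 y (self_mem_cone y) (f w) h1
    have h3 := hf w
    show G.dist x (φ (f w)) ≤ G.dist x y' + j
    omega
  · intro f _ g _ hfg
    ext w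
    exact φ.injective (DFunLike.congr_fun hfg w)

include hfin in
lemma rootedCount_out [Finite W] (hH : H.Connected) (hK : ∀ w, H.dist w₀ w ≤ K) (j : ℕ) (y : V) :
    rootedCount G H x w₀ j y =
      rootedCount G H x w₀ j (Quotient.mk (coneSetoid hG x K) y).out := by
  obtain ⟨φ, hφ⟩ := Quotient.exact (Quotient.out_eq (Quotient.mk (coneSetoid hG x K) y))
  exact le_antisymm (rootedCount_le_of_coneLevelEq hG hfin hH hK hφ.2 j)
    (rootedCount_le_of_coneLevelEq hG hfin hH hK hφ.1 j)

include hG in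
lemma rootedCount_eq_of_le (hH : H.Connected) (hK : ∀ w, H.dist w₀ w ≤ K) {j : ℕ} (hj : K ≤ j)
    (z : V) : rootedCount G H x w₀ j z = rootedCount G H x w₀ K z := by
  have h1 : ∀ j, K ≤ j → rootedCount G H x w₀ j z = {f : H ↪g G | f w₀ = z}.ncard := by
    intro j hj
    rw [rootedCount]
    congr 1
    ext f
    refine ⟨fun hf => hf.1, fun hf => ⟨hf, fun w => ?_⟩⟩
    have h2 := (dist_le_dist_hom hH f.toHom w₀ w).trans (hK w)
    have h3 := hG.dist_triangle (u := x) (v := f w₀) (w := f w)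
    rw [Set.mem_ofPred_eq] at hf
    change G.dist (f w₀) (f w) ≤ K at h2
    rw [hf] at h2 h3
    omega
  rw [h1 j hj, h1 K le_rfl]

lemma ncard_embeddings_eq [Finite W] (w₀ : W) (n : ℕ) :
    {f : H ↪g G | ∀ w, G.dist x (f w) ≤ n}.ncard =
      ∑ i ∈ Finset.range (n + 1), ∑ z ∈ sphereFinset hG hfin x i,
        rootedCount G H x w₀ (n - i) z := by
  classical
  set E := (finite_embeddings (H := H) hG hfin x n).toFinset with hE
  have hmem : ∀ f, f ∈ E ↔ ∀ w, G.dist x (f w) ≤ n := fun f => by simp [hE]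
  rw [Set.ncard_eq_toFinset_card _ (finite_embeddings (H := H) hG hfin x n), ← hE,
    Finset.card_eq_sum_card_fiberwise (f := fun f => G.dist x (f w₀))
      (t := Finset.range (n + 1)) fun f hf =>
        Finset.mem_coe.2 (Finset.mem_range_succ_iff.2 ((hmem f).1 hf w₀))]
  refine Finset.sum_congr rfl fun i hi => ?_
  rw [Finset.card_eq_sum_card_fiberwise (f := fun f : H ↪g G => f w₀)
      (t := sphereFinset hG hfin x i) fun f hf =>
        Finset.mem_coe.2 ((mem_sphereFinset hG hfin).2 (Finset.mem_filter.1 hf).2)]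
  refine Finset.sum_congr rfl fun z hz => ?_
  rw [mem_sphereFinset] at hz
  rw [rootedCount, ← Set.ncard_coe_finset]
  congr 1
  ext f
  have hin := Finset.mem_range_succ_iff.1 hi
  simp only [Finset.coe_filter, Finset.mem_filter, hmem, Set.mem_ofPred_eq, hz,
    Nat.add_sub_cancel' hin]
  constructor
  · exact fun h => ⟨h.2, h.1.1⟩
  · exact fun h => ⟨⟨h.2, by rw [h.1, hz]⟩, h.1⟩

lemma card_embeddings_induce (n : ℕ) :
    Nat.card (H ↪g G.induce (ball G x n)) =
      {f : H ↪g G | ∀ w, G.dist x (f w) ≤ n}.ncard := by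
  rw [← Nat.card_coe_set_eq]
  refine Nat.card_congr
    { toFun := fun e => ⟨(Embedding.induce (ball G x n)).comp e, fun w => (e w).2⟩
      invFun := fun f => ⟨⟨fun w => ⟨f.1 w, f.2 w⟩, fun a b h =>
        f.1.injective (congrArg Subtype.val h)⟩, f.1.map_rel_iff'⟩
      left_inv := fun e => rfl
      right_inv := fun f => rfl }

theorem regularGrowth_embeddings (hG : G.Connected) (hfin : UnifFiniteValence G) {δ : ℝ}
    (hδ : IsDeltaHyperbolic G δ) (htrans : VertexTransitive G) (x : V) [Fintype W]
    (hH : H.Connected) :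
    RegularGrowth (PowerSeries.mk fun n =>
      ({f : H ↪g G | ∀ w, G.dist x (f w) ≤ n}.ncard : ℝ)) := by
  obtain ⟨w₀⟩ := hH.nonempty
  set K := 1 + Finset.univ.sup (fun w => H.dist w₀ w) with hK
  have hK1 : 1 ≤ K := Nat.le_add_right _ _
  have hKw : ∀ w, H.dist w₀ w ≤ K := fun w =>
    (Finset.le_sup (f := fun w => H.dist w₀ w) (Finset.mem_univ w)).trans (Nat.le_add_left _ _)
  have := finite_coneType (x := x) hG hfin hδ htrans hK1
  have := Fintype.ofFinite (Quotient (coneSetoid hG x K))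
  have hQ : ∀ τ : Quotient (coneSetoid hG x K), RegularGrowth
      (PowerSeries.mk fun j => (rootedCount G H x w₀ j τ.out : ℝ)) := fun τ =>
    regularGrowth_of_eventually_const (k := K) (fun n => Nat.cast_nonneg _) fun n hn => by
      rw [rootedCount_eq_of_le hG hH hKw hn]
  convert RegularGrowth.sum Finset.univ fun τ (_ : τ ∈ Finset.univ) =>
    (regularGrowth_sphereSeries hG hfin hK1 τ).mul (hQ τ) using 1
  ext n
  rw [PowerSeries.coeff_mk, ncard_embeddings_eq hG hfin w₀, map_sum]
  simp only [coeff_mul_eq_sum_range]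
  rw [Finset.sum_comm, Nat.cast_sum]
  refine Finset.sum_congr rfl fun i _ => ?_
  simp only [sphereSeries, PowerSeries.coeff_mk]
  rw [← sum_eq_sum_classCount _ _ fun τ => (rootedCount G H x w₀ (n - i) τ.out : ℝ), Nat.cast_sum]
  exact Finset.sum_congr rfl fun y _ => by rw [rootedCount_out hG hfin hH hKw]

end Embeddings

end CF

namespace CF

/-- Finiteness of opposite series: for a nonelementary δ-hyperbolike
graph `G` and a finite connected graph `H` embedding in the ball `X_m`, the set of
opposite series of the generating function `Σ_{n} (H|X_{n+m}) tⁿ` is finite. -/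
theorem opposite_series_finite {V W : Type*} (G : SimpleGraph V) (δ : ℝ)
    (hG : Hyperbolike G δ) (x : V) (hne : Nonelementary G)
    [Fintype W] (H : SimpleGraph W) (hH : H.Connected)
    (m : ℕ) (hm : Nonempty (H ↪g G.induce (ball G x m))) :
    {ω : ℕ → ℝ | OppositeSeries
        (fun n : ℕ => (Nat.card (H ↪g G.induce (ball G x (n + m))) : ℝ)) ω}.Finite := by
  obtain ⟨hconn, hfin, -, hδ, htrans⟩ := hG
  have hreg := regularGrowth_embeddings hconn hfin hδ htrans x hH
  have hle : ∀ n k, n ≤ k → {f : H ↪g G | ∀ w, G.dist x (f w) ≤ n}.ncard ≤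
      {f : H ↪g G | ∀ w, G.dist x (f w) ≤ k}.ncard := fun n k hnk =>
    Set.ncard_le_ncard (fun f hf w => (hf w).trans hnk) (finite_embeddings hconn hfin x k)
  have hpos : 0 < {f : H ↪g G | ∀ w, G.dist x (f w) ≤ m}.ncard := by
    obtain ⟨e⟩ := hm
    rw [Set.ncard_pos (finite_embeddings hconn hfin x m)]
    exact ⟨(Embedding.induce (ball G x m)).comp e, fun w => (e w).2⟩
  have := hreg.finite_oppositeSeries (fun n k hnk => by
    simpa only [PowerSeries.coeff_mk] using Nat.cast_le.2 (hle n k hnk)) m (by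
    rw [PowerSeries.coeff_mk]
    exact Nat.cast_pos.2 hpos)
  simpa only [PowerSeries.coeff_mk, card_embeddings_induce] using this

end CF
end
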